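/- There is a universal constant C such that the following holds. Let (X,d) be a metric space, let r ∈ X, and let M ≥ 1 cable types be given, with fixed costs 0 < σ_1 < σ_2 < ⋯ < σ_M and incremental costs β_1 > β_2 > ⋯ > β_M > 0. Then there exists an online algorithm A — a function that assigns to every finite sequence (v_1,…,v_t) of points of X a path P_t from v_t to r together with a cable type i_t(e) ∈ {1,…,M} for every edge e of P_t, where the outputs produced on a prefix of a sequence coincide with those produced on the sequence itself — such that for every input sequence v_1,…,v_k of k ≥ 1 terminals, cost(A) ≤ C·(1 + log₂ k)·OPT. Here cost(A) = Σ_{(e,i) : i = i_t(e) for some t with e an edge of P_t} σ_i·d(e) + Σ_{t=1}^{k} Σ_{e edge of P_t} β_{i_t(e)}·d(e), and OPT is the infimum, over all choices of a path Q_s from v_s to r for each s ∈ {1,…,k} and of a single cable type j(e) ∈ {1,…,M} for each edge e occurring in some Q_s, of Σ_e d(e)·(σ_{j(e)} + β_{j(e)}·n_e), where n_e is the number of indices s such that e is an edge of Q_s. -/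

import Mathlib

open MeasureTheory
open scoped Classical ENNReal

noncomputable section

variable {X : Type*} [MetricSpace X]

/-- The length of an unordered pair of points: the distance between its endpoints. -/
def edgeLen (e : Sym2 X) : ℝ :=
  Sym2.lift ⟨fun x y => dist x y, fun x y => dist_comm x y⟩ e

/-- The edges of a path: the unordered pairs of consecutive points. -/
def edgeList (p : List X) : List (Sym2 X) :=
  (p.zip p.tail).map fun ab => s(ab.1, ab.2)

/-- `p` is a path from `v` to `r`: a finite sequence of points starting at `v`
and ending at `r`. -/
def IsPath (v r : X) (p : List X) : Prop :=
  p.head? = some v ∧ p.getLast? = some r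

/-- All edges occurring in some path of a routing. -/
def allEdges {k : ℕ} (P : Fin k → List X) : Finset (Sym2 X) :=
  Finset.univ.biUnion fun s => (edgeList (P s)).toFinset

/-- The load of an edge `e` under a routing `P`: the number of indices `s`
such that `e` is an edge of `P s`. -/
def load {k : ℕ} (P : Fin k → List X) (e : Sym2 X) : ℕ :=
  (Finset.univ.filter fun s => e ∈ edgeList (P s)).card

/-- The cost of a routing `P` under the cost function `f`:
`∑_{e : load_e(P) > 0} d(e) · f(load_e(P))`. -/
def costf {k : ℕ} (f : ℝ → ℝ) (P : Fin k → List X) : ℝ :=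
  ∑ e ∈ allEdges P, edgeLen e * f (load P e)

/-- The optimal cost, under `f`, of routing the terminals `v` to the root `r`. -/
def OPTf {k : ℕ} (f : ℝ → ℝ) (v : Fin k → X) (r : X) : ℝ :=
  sInf { c | ∃ P : Fin k → List X, (∀ s, IsPath (v s) r (P s)) ∧ c = costf f P }

theorem edgeLen_nonneg (e : Sym2 X) : 0 ≤ edgeLen e := by
  induction e using Sym2.ind with
  | _ x y => exact dist_nonneg

theorem isPath_singleton {X : Type*} (a : X) : IsPath a a [a] := ⟨rfl, rfl⟩

theorem edgeList_singleton {X : Type*} (a : X) : edgeList [a] = [] := rfl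

theorem isPath_cons {X : Type*} {a b c : X} {p : List X} (h : IsPath b c p) :
    IsPath a c (a :: p) := by
  obtain ⟨h1, h2⟩ := h
  cases p with
  | nil => simp at h1
  | cons x q => exact ⟨rfl, by simpa using h2⟩

theorem edgeList_cons {X : Type*} {a b c : X} {p : List X} (h : IsPath b c p) :
    edgeList (a :: p) = s(a, b) :: edgeList p := by
  obtain ⟨h1, h2⟩ := h
  cases p with
  | nil => simp at h1
  | cons x q =>
    obtain rfl : x = b := by simpa using h1
    simp [edgeList]

/-- Induction on paths: a path is trivial or a first edge followed by a path. -/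
theorem IsPath.rec_cons {X : Type*} {c : X} {motive : X → List X → Prop}
    (single : motive c [c])
    (cons : ∀ a b p, IsPath b c p → motive b p → motive a (a :: p))
    {a : X} {p : List X} (h : IsPath a c p) : motive a p := by
  induction p generalizing a with
  | nil => simp [IsPath] at h
  | cons x q ih =>
    obtain ⟨h1, h2⟩ := h
    obtain rfl : x = a := by simpa using h1
    cases q with
    | nil =>
      obtain rfl : x = c := by simpa using h2
      exact single
    | cons y q' =>
      have hq : IsPath y c (y :: q') := ⟨rfl, by simpa using h2⟩
      exact cons x y _ hq (ih hq)

theorem IsPath.trans {X : Type*} {a b c : X} {p q : List X} (hp : IsPath a b p)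
    (hq : IsPath b c q) :
    ∃ p', IsPath a c p' ∧ edgeList p' = edgeList p ++ edgeList q := by
  refine IsPath.rec_cons (motive := fun a p => ∃ p', IsPath a c p' ∧
    edgeList p' = edgeList p ++ edgeList q) ⟨q, hq, by simp [edgeList_singleton]⟩ ?_ hp
  rintro a b p h ⟨p', h1, h2⟩
  exact ⟨a :: p', isPath_cons h1, by rw [edgeList_cons h1, edgeList_cons h, h2]; rfl⟩

theorem mem_of_mem_edgeList {X : Type*} {p : List X} {e : Sym2 X} {x : X} (he : e ∈ edgeList p)
    (hx : x ∈ e) : x ∈ p := by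
  simp only [edgeList, List.mem_map, Prod.exists] at he
  obtain ⟨a, b, hab, rfl⟩ := he
  have h := List.of_mem_zip hab
  rcases Sym2.mem_iff.1 hx with rfl | rfl
  · exact h.1
  · exact List.mem_of_mem_tail h.2

theorem exists_suffix_isPath {X : Type*} {a b c : X} {p : List X} (h : IsPath b c p) (ha : a ∈ p) :
    ∃ q, IsPath a c q ∧ edgeList q ⊆ edgeList p ∧ q.length ≤ p.length := by
  revert ha
  refine IsPath.rec_cons (motive := fun b p => a ∈ p →
    ∃ q, IsPath a c q ∧ edgeList q ⊆ edgeList p ∧ q.length ≤ p.length) ?_ ?_ h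
  · intro ha
    obtain rfl : a = c := by simpa using ha
    exact ⟨[a], isPath_singleton a, by simp, le_rfl⟩
  · intro x y p hp ih ha
    by_cases hax : a = x
    · subst hax
      exact ⟨a :: p, isPath_cons hp, by simp, le_rfl⟩
    · obtain ⟨q, h1, h2, h3⟩ := ih (by simpa [hax] using ha)
      refine ⟨q, h1, ?_, by simp; omega⟩
      rw [edgeList_cons hp]
      exact fun e he => List.mem_cons_of_mem _ (h2 he)

/-- A function changes along a path by at most the sum of its variations over the
distinct edges. -/
theorem sub_le_sum_edges {X : Type*} (φ : X → ℝ) (g : Sym2 X → ℝ) (hg : ∀ e, 0 ≤ g e)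
    (hφ : ∀ x y, φ y - φ x ≤ g s(x, y)) {a c : X} {p : List X} (h : IsPath a c p) :
    φ c - φ a ≤ ∑ e ∈ (edgeList p).toFinset, g e := by
  induction hn : p.length using Nat.strong_induction_on generalizing a p with
  | _ n ih =>
    subst hn
    revert ih
    refine IsPath.rec_cons (motive := fun a p => (∀ m < p.length, ∀ {a : X} {q : List X},
      IsPath a c q → q.length = m → φ c - φ a ≤ ∑ e ∈ (edgeList q).toFinset, g e) →
      φ c - φ a ≤ ∑ e ∈ (edgeList p).toFinset, g e) ?_ ?_ h
    · intro _; simp [edgeList_singleton]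
    · intro a b p hp _ ih
      by_cases hap : a ∈ p
      · obtain ⟨q, h1, h2, h3⟩ := exists_suffix_isPath hp hap
        refine (ih q.length (by simp; omega) h1 rfl).trans ?_
        refine Finset.sum_le_sum_of_subset_of_nonneg ?_ fun e _ _ => hg e
        intro e he
        rw [edgeList_cons hp]
        simp only [List.mem_toFinset] at he ⊢
        exact List.mem_cons_of_mem _ (h2 he)
      · have hb := ih p.length (by simp) hp rfl
        rw [edgeList_cons hp, List.toFinset_cons, Finset.sum_insert]
        · linarith [hφ a b]
        · intro he
          exact hap (mem_of_mem_edgeList (List.mem_toFinset.1 he) (Sym2.mem_mk_left a b))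

/-- The total length of the distinct edges of a path. -/
def pathLen (p : List X) : ℝ := ∑ e ∈ (edgeList p).toFinset, edgeLen e

theorem pathLen_nonneg (p : List X) : 0 ≤ pathLen p :=
  Finset.sum_nonneg fun e _ => edgeLen_nonneg e

theorem pathLen_singleton (a : X) : pathLen [a] = 0 := by
  simp [pathLen, edgeList_singleton]

theorem IsPath.dist_le {a c : X} {p : List X} (h : IsPath a c p) : dist a c ≤ pathLen p := by
  have := sub_le_sum_edges (fun x => dist a x) edgeLen edgeLen_nonneg
    (fun x y => by
      change dist a y - dist a x ≤ dist x y
      linarith [dist_triangle a x y]) h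
  simpa [pathLen] using this

theorem sum_append_toFinset_le {α : Type*} [DecidableEq α] (f : α → ℝ) (hf : ∀ e, 0 ≤ f e)
    (L₁ L₂ : List α) :
    ∑ e ∈ (L₁ ++ L₂).toFinset, f e ≤ ∑ e ∈ L₁.toFinset, f e + ∑ e ∈ L₂.toFinset, f e := by
  rw [List.toFinset_append, ← Finset.sum_union_inter]
  exact le_add_of_nonneg_right (Finset.sum_nonneg fun e _ => hf e)

theorem pathLen_le_of_edgeList_eq {p q p' : List X}
    (h : edgeList p' = edgeList p ++ edgeList q) : pathLen p' ≤ pathLen p + pathLen q := by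
  rw [pathLen, h]
  exact sum_append_toFinset_le edgeLen edgeLen_nonneg (edgeList p) (edgeList q)

/-- If weighted terminals far from the root have total weight at most `W n` among any `n` of them
inside a ball of radius `ρ`, then the cost of every routing under `W` is bounded below. -/
theorem mul_sum_weight_le {k : ℕ} {r : X} (x : ℕ → X) (Q : Fin k → List X)
    (hQ : ∀ s : Fin k, IsPath (x s) r (Q s)) (ρ : ℝ) (c : ℕ → ℝ) (hc : ∀ s, 0 ≤ c s)
    (hfar : ∀ s, c s ≠ 0 → ρ ≤ dist (x s) r) (W : ℕ → ℝ)
    (hW : ∀ (z : X) (T : Finset ℕ), ∑ s ∈ T with dist (x s) z < ρ, c s ≤ W T.card) :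
    ρ * ∑ s ∈ Finset.range k, c s ≤ 2 * ∑ e ∈ allEdges Q, edgeLen e * W (load Q e) := by
  let near : ℕ → Sym2 X → Prop := fun s e => ∃ z ∈ e, dist (x s) z < ρ
  have h1 : ∀ s : Fin k, ρ * c s ≤
      ∑ e ∈ allEdges Q, if e ∈ edgeList (Q s) ∧ near s e then edgeLen e * c s else 0 := by
    intro s
    by_cases h0 : c s = 0
    · simp [h0]
    have hρ := hfar s h0
    have hcs := hc s
    have := sub_le_sum_edges (fun y => min ρ (dist (x s) y))
      (fun e => if near s e then edgeLen e else 0)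
      (fun e => by split_ifs <;> simp [edgeLen_nonneg])
      (fun y z => by
        have hyz : edgeLen s(y, z) = dist y z := rfl
        have := dist_triangle (x s) y z
        split_ifs with hn
        · rw [hyz]
          rcases le_total ρ (dist (x s) y) with h | h
          · rw [min_eq_left h]
            linarith [min_le_left ρ (dist (x s) z), dist_nonneg (x := y) (y := z)]
          · rw [min_eq_right h]; linarith [min_le_right ρ (dist (x s) z)]
        · have hy : ρ ≤ dist (x s) y := not_lt.1 fun h => hn ⟨y, Sym2.mem_mk_left y z, h⟩
          rw [min_eq_left hy]; linarith [min_le_left ρ (dist (x s) z)])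
      (hQ s)
    rw [min_eq_left hρ] at this
    have h2 : ρ ≤ ∑ e ∈ (edgeList (Q s)).toFinset, if near s e then edgeLen e else 0 := by
      rcases le_total 0 ρ with h | h
      · simpa [min_eq_right h] using this
      · exact h.trans (Finset.sum_nonneg fun e _ => by split_ifs <;> simp [edgeLen_nonneg])
    calc ρ * c s ≤ (∑ e ∈ (edgeList (Q s)).toFinset, if near s e then edgeLen e else 0) * c s :=
          mul_le_mul_of_nonneg_right h2 hcs
      _ = ∑ e ∈ (edgeList (Q s)).toFinset,
            if e ∈ edgeList (Q s) ∧ near s e then edgeLen e * c s else 0 := by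
          rw [Finset.sum_mul]
          refine Finset.sum_congr rfl fun e he => ?_
          simp [List.mem_toFinset.1 he]
      _ ≤ _ := by
          refine Finset.sum_le_sum_of_subset_of_nonneg ?_ ?_
          · exact Finset.subset_biUnion_of_mem (fun s => (edgeList (Q s)).toFinset)
              (Finset.mem_univ s)
          · intro e _ _
            split_ifs
            · exact mul_nonneg (edgeLen_nonneg e) hcs
            · exact le_rfl
  have h2 : ∀ e, (∑ s : Fin k, if e ∈ edgeList (Q s) ∧ near s e then edgeLen e * c s else 0) ≤
      edgeLen e * (2 * W (load Q e)) := by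
    intro e
    induction e using Sym2.ind with
    | _ y z =>
      set e := s(y, z) with he
      let T : Finset ℕ := (Finset.univ.filter fun s => e ∈ edgeList (Q s)).map Fin.valEmbedding
      have hT : T.card = load Q e := by simp [T, load]
      have key : ∀ w, (∑ s : Fin k, if e ∈ edgeList (Q s) ∧ dist (x s) w < ρ then c s else 0) ≤
          W (load Q e) := by
        intro w
        have := hW w T
        rw [hT] at this
        refine le_trans (le_of_eq ?_) this
        rw [Finset.sum_filter, Finset.sum_map, Finset.sum_filter]
        refine Finset.sum_congr rfl fun s _ => ?_
        by_cases h : e ∈ edgeList (Q s) <;> simp [h]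
      have h3 : (∑ s : Fin k, if e ∈ edgeList (Q s) ∧ near s e then edgeLen e * c s else 0) ≤
          edgeLen e * ((∑ s : Fin k, if e ∈ edgeList (Q s) ∧ dist (x s) y < ρ then c s else 0) +
          ∑ s : Fin k, if e ∈ edgeList (Q s) ∧ dist (x s) z < ρ then c s else 0) := by
        rw [← Finset.sum_add_distrib, Finset.mul_sum]
        refine Finset.sum_le_sum fun s _ => ?_
        have hcs := hc s
        have hle := edgeLen_nonneg e
        have hnear : near s e ↔ dist (x s) y < ρ ∨ dist (x s) z < ρ := by
          simp [near, he]
        have := mul_nonneg hle hcs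
        by_cases h : e ∈ edgeList (Q s) <;> by_cases hy : dist (x s) y < ρ <;>
          by_cases hz : dist (x s) z < ρ <;> (simp [h, hy, hz, hnear]; try nlinarith)
      refine h3.trans (mul_le_mul_of_nonneg_left ?_ (edgeLen_nonneg e))
      linarith [key y, key z]
  calc ρ * ∑ s ∈ Finset.range k, c s = ∑ s : Fin k, ρ * c s := by
        rw [Finset.sum_range, Finset.mul_sum]
    _ ≤ ∑ s : Fin k, ∑ e ∈ allEdges Q,
          if e ∈ edgeList (Q s) ∧ near s e then edgeLen e * c s else 0 :=
        Finset.sum_le_sum fun s _ => h1 s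
    _ = ∑ e ∈ allEdges Q, ∑ s : Fin k,
          if e ∈ edgeList (Q s) ∧ near s e then edgeLen e * c s else 0 := Finset.sum_comm
    _ ≤ ∑ e ∈ allEdges Q, edgeLen e * (2 * W (load Q e)) :=
        Finset.sum_le_sum fun e _ => h2 e
    _ = _ := by rw [Finset.mul_sum]; exact Finset.sum_congr rfl fun e _ => by ring

theorem sum_two_zpow_le (J : Finset ℤ) (n : ℤ) (hJ : ∀ j ∈ J, j ≤ n) :
    ∑ j ∈ J, (2 : ℝ) ^ j ≤ 2 ^ (n + 1) := by
  induction J using Finset.induction_on_max generalizing n with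
  | empty => simp; positivity
  | insert a s hs ih =>
    rw [Finset.sum_insert fun h => lt_irrefl _ (hs a h)]
    have h1 := ih (a - 1) fun j hj => by have := hs j hj; omega
    have h2 : (2 : ℝ) ^ (a + 1) ≤ 2 ^ (n + 1) :=
      zpow_le_zpow_right₀ (by norm_num) (by have := hJ a (Finset.mem_insert_self _ _); omega)
    rw [sub_add_cancel] at h1
    rw [zpow_add_one₀ (by norm_num : (2 : ℝ) ≠ 0) a] at h2
    linarith

theorem sum_min_one_two_zpow_le (J : Finset ℤ) (D : ℝ) (hD : 0 < D) (k : ℕ) (hk : 1 ≤ k)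
    (hJ : ∀ j ∈ J, (2 : ℝ) ^ j ≤ 2 * D) :
    ∑ j ∈ J, min 1 ((2 : ℝ) ^ j * k / D) ≤ 4 * (1 + Real.logb 2 k) := by
  have hk' : (1 : ℝ) ≤ k := by exact_mod_cast hk
  have hk0 : (0 : ℝ) < k := by linarith
  have hDk : 0 < D / k := by positivity
  set n₀ := Int.log 2 (D / k) with hn₀
  set n₁ := Int.log 2 (2 * D) with hn₁
  have h1 : (2 : ℝ) ^ n₀ ≤ D / k := by simpa using Int.zpow_log_le_self (b := 2) (by norm_num) hDk
  have h2 : D / k < (2 : ℝ) ^ (n₀ + 1) := by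
    simpa using Int.lt_zpow_succ_log_self (b := 2) (by norm_num) (D / k)
  have h3 : (2 : ℝ) ^ n₁ ≤ 2 * D := by
    simpa using Int.zpow_log_le_self (b := 2) (by norm_num) (show 0 < 2 * D by positivity)
  have hlog0 : 0 ≤ Real.logb 2 k := Real.logb_nonneg (by norm_num) hk'
  rw [← Finset.sum_filter_add_sum_filter_not J (fun j => j ≤ n₀)]
  have hA : ∑ j ∈ J with j ≤ n₀, min 1 ((2 : ℝ) ^ j * k / D) ≤ 2 := by
    calc _ ≤ ∑ j ∈ J with j ≤ n₀, (2 : ℝ) ^ j * (k / D) :=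
          Finset.sum_le_sum fun j _ => (min_le_right _ _).trans (le_of_eq (by ring))
      _ = (∑ j ∈ J with j ≤ n₀, (2 : ℝ) ^ j) * (k / D) := by rw [Finset.sum_mul]
      _ ≤ 2 ^ (n₀ + 1) * (k / D) :=
          mul_le_mul_of_nonneg_right
            (sum_two_zpow_le _ _ fun j hj => (Finset.mem_filter.1 hj).2) (by positivity)
      _ ≤ (2 * (D / k)) * (k / D) := by
          refine mul_le_mul_of_nonneg_right ?_ (by positivity)
          rw [zpow_add_one₀ (by norm_num)]; linarith
      _ = 2 := by field_simp
  have hB : ∑ j ∈ J with ¬ j ≤ n₀, min 1 ((2 : ℝ) ^ j * k / D) ≤ 2 + Real.logb 2 k := by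
    have hsub : (J.filter fun j => ¬ j ≤ n₀) ⊆ Finset.Ioc n₀ n₁ := by
      intro j hj
      rw [Finset.mem_filter] at hj
      rw [Finset.mem_Ioc]
      refine ⟨not_le.1 hj.2, ?_⟩
      exact (Int.zpow_le_iff_le_log (b := 2) (by norm_num) (by positivity)).1
        (by simpa using hJ j hj.1)
    have hexp : ((n₁ - n₀ - 1 : ℤ) : ℝ) ≤ 1 + Real.logb 2 k := by
      have h4 : (2 : ℝ) ^ (n₁ - n₀ - 1) ≤ 2 * k := by
        have : (2 : ℝ) ^ n₁ = 2 ^ (n₁ - n₀ - 1) * 2 ^ (n₀ + 1) := by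
          rw [← zpow_add₀ (by norm_num)]; congr 1; ring
        rw [this] at h3
        have h5 : (2 : ℝ) ^ (n₁ - n₀ - 1) * (D / k) ≤ 2 * D :=
          (mul_le_mul_of_nonneg_left h2.le (by positivity)).trans h3
        rw [mul_div_assoc', div_le_iff₀ hk0] at h5
        nlinarith
      have h6 : Real.logb 2 (2 * k) = 1 + Real.logb 2 k := by
        rw [Real.logb_mul (by norm_num) hk0.ne', Real.logb_self_eq_one (by norm_num)]
      rw [← h6, Real.le_logb_iff_rpow_le (by norm_num) (by positivity), Real.rpow_intCast]
      exact h4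
    calc _ ≤ ∑ j ∈ J with ¬ j ≤ n₀, (1 : ℝ) := Finset.sum_le_sum fun j _ => min_le_left _ _
      _ ≤ ((Finset.Ioc n₀ n₁).card : ℝ) := by
          rw [Finset.sum_const, nsmul_eq_mul, mul_one]
          exact_mod_cast Finset.card_le_card hsub
      _ ≤ 2 + Real.logb 2 k := by
          rw [Int.card_Ioc]
          have : (((n₁ - n₀).toNat : ℤ) : ℝ) ≤ 2 + Real.logb 2 k := by
            rcases le_total 0 (n₁ - n₀) with h | h
            · rw [Int.toNat_of_nonneg h]; push_cast at hexp ⊢; linarith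
            · rw [Int.toNat_of_nonpos h]; push_cast; linarith
          exact_mod_cast this
  linarith

/-- Pruning the cables of index at least `p` to a subsequence with geometrically decreasing
incremental costs that is as good as all of them, up to constants. -/
theorem exists_cable_selection_from {M : ℕ} (σ β : Fin M → ℝ) (hσ : ∀ i, 0 < σ i)
    (hσm : StrictMono σ) (hβ : ∀ i, 0 < β i) (hβm : StrictAnti β) (p : Fin M) :
    ∃ (m : ℕ) (idx : ℕ → Fin M), 1 ≤ m ∧ σ (idx 0) ≤ 2 * σ p ∧ β (idx 0) ≤ β p ∧
      (∀ l, l + 1 < m → 32 * β (idx (l + 1)) ≤ β (idx l)) ∧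
      ∑ l ∈ Finset.range m, β (idx l) ≤ 2 * β (idx 0) ∧
      ∀ c, p ≤ c → ∀ n : ℝ, 0 ≤ n →
        σ (idx 0) + ∑ l ∈ Finset.range m,
          (if l + 1 < m then min (β (idx l) * n) (σ (idx (l + 1))) else β (idx l) * n) ≤
        4 * σ c - 2 * σ p + 64 * β c * n := by
  induction hp : M - p.1 using Nat.strong_induction_on generalizing p with
  | _ d ih =>
  subst hp
  have hne : (Finset.univ.filter fun i => σ i ≤ 2 * σ p).Nonempty :=
    ⟨p, by simp; linarith [hσ p]⟩
  obtain ⟨i, hi, himax⟩ := Finset.exists_max_image _ (fun i : Fin M => i) hne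
  replace hi : σ i ≤ 2 * σ p := by simpa using hi
  replace himax : ∀ j, σ j ≤ 2 * σ p → j ≤ i := fun j hj => himax j (by simpa using hj)
  have hpi : p ≤ i := himax p (by linarith [hσ p])
  have hβi : β i ≤ β p := hβm.antitone hpi
  by_cases hex : (Finset.univ.filter fun j => 32 * β j ≤ β i).Nonempty
  · obtain ⟨q, hq, hqmin⟩ := Finset.exists_min_image _ (fun j : Fin M => j) hex
    replace hq : 32 * β q ≤ β i := by simpa using hq
    replace hqmin : ∀ j, 32 * β j ≤ β i → q ≤ j := fun j hj => hqmin j (by simpa using hj)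
    have hiq : i < q := by
      by_contra h
      have := hβm.antitone (not_lt.1 h)
      linarith [hβ q]
    have hσq : 2 * σ p < σ q := by
      by_contra h
      exact absurd (himax q (not_lt.1 h)) (not_le.2 hiq)
    have hpq : p < q := hpi.trans_lt hiq
    obtain ⟨m, idx, hm, h1, h2, h3, h4, h5⟩ := ih (M - q.1)
      (by have := q.2; have : p.1 < q.1 := hpq; omega) q rfl
    have hsum : ∑ l ∈ Finset.range (m + 1), β (if l = 0 then i else idx (l - 1)) ≤ 2 * β i := by
      rw [Finset.sum_range_succ']
      simp only [Nat.add_sub_cancel, Nat.succ_ne_zero, if_false, if_true]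
      linarith [hβ i]
    refine ⟨m + 1, fun l => if l = 0 then i else idx (l - 1), by omega, by simpa using hi,
      by simpa using hβi, ?_, by simpa using hsum, ?_⟩
    · intro l hl
      rcases l with _ | l
      · simp; linarith
      · simpa using h3 l (by omega)
    · intro c hc n hn
      by_cases hcq : q ≤ c
      · have := h5 c hcq n hn
        rw [Finset.sum_range_succ']
        simp only [Nat.add_sub_cancel, Nat.succ_ne_zero, if_false, if_true, add_lt_add_iff_right,
          zero_add, Nat.sub_self, one_ne_zero]
        rw [if_pos (by omega : 1 < m + 1)]
        linarith [min_le_right (β i * n) (σ (idx 0))]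
      · have hβc : β i < 32 * β c := by
          by_contra h
          exact hcq (hqmin c (not_lt.1 h))
        have hσc : σ p ≤ σ c := hσm.monotone hc
        have hle : ∑ l ∈ Finset.range (m + 1),
            (if l + 1 < m + 1 then
              min (β (if l = 0 then i else idx (l - 1)) * n)
                (σ (if l + 1 = 0 then i else idx (l + 1 - 1)))
            else β (if l = 0 then i else idx (l - 1)) * n) ≤ 2 * β i * n := by
          refine le_trans (Finset.sum_le_sum fun l _ => ?_)
            ((Finset.sum_mul _ _ n).symm.le.trans (mul_le_mul_of_nonneg_right hsum hn))
          split_ifs <;> simp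
        refine (add_le_add_right hle _).trans ?_
        simp only [if_true]
        nlinarith
  · have hall : ∀ c, β i < 32 * β c := by
      intro c
      by_contra h
      exact hex ⟨c, by simpa using h⟩
    refine ⟨1, fun _ => i, le_rfl, hi, hβi, by omega, by simp; linarith [hβ i], ?_⟩
    intro c hc n hn
    have hσc : σ p ≤ σ c := hσm.monotone hc
    have := hall c
    simp
    nlinarith [hβ c]

/-- A geometric subsequence of the cables that is as good as all of them, up to constants. -/
theorem exists_cable_selection {M : ℕ} (hM : 1 ≤ M) (σ β : Fin M → ℝ) (hσ : ∀ i, 0 < σ i)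
    (hσm : StrictMono σ) (hβ : ∀ i, 0 < β i) (hβm : StrictAnti β) :
    ∃ (m : ℕ) (idx : ℕ → Fin M), 1 ≤ m ∧
      (∀ l, l + 1 < m → 32 * β (idx (l + 1)) ≤ β (idx l)) ∧
      ∀ c, ∀ n : ℕ, 1 ≤ n →
        σ (idx 0) + ∑ l ∈ Finset.range m,
          (if l + 1 < m then min (β (idx l) * n) (σ (idx (l + 1))) else β (idx l) * n) +
        (σ (idx 0) + ∑ l ∈ Finset.range m, β (idx l)) ≤
        66 * (σ c + β c * n) := by
  obtain ⟨p, -, hp⟩ := Finset.exists_min_image Finset.univ (fun i : Fin M => σ i + β i)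
    ⟨⟨0, hM⟩, Finset.mem_univ _⟩
  replace hp : ∀ c, σ p + β p ≤ σ c + β c := fun c => hp c (Finset.mem_univ c)
  obtain ⟨m, idx, hm, h1, h2, h3, h4, h5⟩ := exists_cable_selection_from σ β hσ hσm hβ hβm p
  refine ⟨m, idx, hm, h3, ?_⟩
  have key : ∀ c, p ≤ c → ∀ n : ℕ, 1 ≤ n →
      σ (idx 0) + ∑ l ∈ Finset.range m,
          (if l + 1 < m then min (β (idx l) * n) (σ (idx (l + 1))) else β (idx l) * n) +
        (σ (idx 0) + ∑ l ∈ Finset.range m, β (idx l)) ≤ 66 * (σ c + β c * n) := by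
    intro c hc n hn
    have hn' : (1 : ℝ) ≤ n := by exact_mod_cast hn
    have := h5 c hc n (by linarith)
    have := hp c
    nlinarith [hβ c, hσ c, hσ p, mul_le_mul_of_nonneg_left hn' (hβ c).le]
  intro c n hn
  have hn' : (1 : ℝ) ≤ n := by exact_mod_cast hn
  rcases le_total p c with hc | hc
  · exact key c hc n hn
  · refine (key p le_rfl n hn).trans ?_
    have h6 := hβm.antitone hc
    have := hp c
    nlinarith

/-- The state of one level of the algorithm: its hubs in the order of opening, the scale and the
parent of each hub, and the number of earlier terminals of a given class close to a point. -/
structure HubState (X : Type*) where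
  hubs : List X
  scale : X → ℤ
  parent : X → X
  count : X → ℤ → ℕ

namespace HubState

/-- The state before the first terminal: the root is the only hub. -/
def initial (r : X) : HubState X := ⟨[r], fun _ => 0, fun _ => r, fun _ _ => 0⟩

/-- The distance from a point to the nearest hub. -/
def gap (S : HubState X) (x : X) : ℝ := Metric.infDist x {y | y ∈ S.hubs}

/-- The class of a point: the dyadic scale of its distance to the nearest hub. -/
def cls (S : HubState X) (x : X) : ℤ := Int.log 2 (S.gap x)

/-- A terminal opens a hub if it is not a hub and enough terminals of its class are close. -/
def Opens (ok : ℕ → Prop) (S : HubState X) (x : X) : Prop :=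
  0 < S.gap x ∧ ok (S.count x (S.cls x) + 1)

/-- `w` is a net point above scale `j` at distance at most `2 ^ j` from `x`. -/
def Covers (r : X) (S : HubState X) (x w : X) (j : ℤ) : Prop :=
  w ∈ S.hubs ∧ (w = r ∨ j < S.scale w) ∧ dist x w ≤ 2 ^ j

/-- The least scale at which a new hub is covered, together with a net point covering it. -/
def link (r : X) (S : HubState X) (x : X) : X × ℤ :=
  @Classical.epsilon _ ⟨(r, 0)⟩ fun p => S.Covers r x p.1 p.2 ∧ ∀ w j, S.Covers r x w j → p.2 ≤ j

/-- The state after the arrival of the terminal `x`. -/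
def step (ok : ℕ → Prop) (r : X) (S : HubState X) (x : X) : HubState X where
  hubs := if S.Opens ok x then S.hubs ++ [x] else S.hubs
  scale := if S.Opens ok x then Function.update S.scale x (S.link r x).2 else S.scale
  parent := if S.Opens ok x then Function.update S.parent x (S.link r x).1 else S.parent
  count y j := S.count y j +
    if 0 < S.gap x ∧ S.cls x = j ∧ dist y x ≤ 2 ^ j / 8 then 1 else 0

/-- The state after the first `t` terminals of the sequence `x`. -/
def run (ok : ℕ → Prop) (r : X) (x : ℕ → X) : ℕ → HubState X
  | 0 => initial r
  | t + 1 => step ok r (run ok r x t) (x t)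

theorem run_congr (ok : ℕ → Prop) (r : X) {x y : ℕ → X} {t : ℕ} (h : ∀ s < t, x s = y s) :
    run ok r x t = run ok r y t := by
  induction t with
  | zero => rfl
  | succ t ih => rw [run, run, ih fun s hs => h s (by omega), h t (by omega)]

theorem gap_nonneg (S : HubState X) (x : X) : 0 ≤ S.gap x := Metric.infDist_nonneg

theorem gap_le_dist {S : HubState X} {w : X} (hw : w ∈ S.hubs) (x : X) : S.gap x ≤ dist x w :=
  Metric.infDist_le_dist_of_mem hw

theorem gap_le_gap_add_dist (S : HubState X) (x y : X) : S.gap x ≤ S.gap y + dist x y :=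
  Metric.infDist_le_infDist_add_dist

theorem exists_gap_eq_dist {S : HubState X} {r : X} (hr : r ∈ S.hubs) (x : X) :
    ∃ w ∈ S.hubs, S.gap x = dist x w := by
  have hfin : Set.Finite {y | y ∈ S.hubs} := List.finite_toSet S.hubs
  exact hfin.isCompact.exists_infDist_eq_dist ⟨r, hr⟩ x

theorem mem_hubs_of_gap_eq_zero {S : HubState X} {r : X} (hr : r ∈ S.hubs) {x : X}
    (h : S.gap x = 0) : x ∈ S.hubs := by
  obtain ⟨w, hw, h'⟩ := exists_gap_eq_dist hr x
  rw [h, eq_comm, dist_eq_zero] at h'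
  exact h' ▸ hw

theorem gap_pos_iff {S : HubState X} {r : X} (hr : r ∈ S.hubs) {x : X} :
    0 < S.gap x ↔ x ∉ S.hubs := by
  refine ⟨fun h hx => ?_, fun h => ?_⟩
  · have := gap_le_dist hx x
    rw [dist_self] at this
    linarith
  · exact lt_of_le_of_ne (S.gap_nonneg x) fun h0 => h (mem_hubs_of_gap_eq_zero hr h0.symm)

theorem two_zpow_cls_le {S : HubState X} {x : X} (h : 0 < S.gap x) :
    (2 : ℝ) ^ S.cls x ≤ S.gap x := by
  simpa [cls] using Int.zpow_log_le_self (b := 2) (by norm_num) h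

theorem gap_lt_two_zpow_cls (S : HubState X) (x : X) : S.gap x < (2 : ℝ) ^ (S.cls x + 1) := by
  simpa [cls] using Int.lt_zpow_succ_log_self (b := 2) (by norm_num) (S.gap x)

theorem link_spec {S : HubState X} {r x : X} (hr : r ∈ S.hubs) (hx : 0 < S.gap x) :
    S.Covers r x (S.link r x).1 (S.link r x).2 ∧
      ∀ w j, S.Covers r x w j → (S.link r x).2 ≤ j := by
  refine Classical.epsilon_spec (p := fun p : X × ℤ =>
    S.Covers r x p.1 p.2 ∧ ∀ w j, S.Covers r x w j → p.2 ≤ j) ?_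
  have hbdd : ∃ b : ℤ, ∀ z : ℤ, (∃ w, S.Covers r x w z) → b ≤ z := by
    refine ⟨S.cls x, fun z ⟨w, hw, _, hd⟩ => ?_⟩
    have := (two_zpow_cls_le hx).trans ((gap_le_dist hw x).trans hd)
    exact (zpow_le_zpow_iff_right₀ (by norm_num)).1 this
  have hne : ∃ z : ℤ, ∃ w, S.Covers r x w z :=
    ⟨Int.log 2 (dist x r) + 1, r, hr, Or.inl rfl, by
      simpa using (Int.lt_zpow_succ_log_self (b := 2) (by norm_num) (dist x r)).le⟩
  obtain ⟨j, ⟨w, hw⟩, hj⟩ := Int.exists_least_of_bdd hbdd hne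
  exact ⟨(w, j), hw, fun w' j' h => hj j' ⟨w', h⟩⟩

section run

variable (ok : ℕ → Prop) (r : X) (x : ℕ → X)

theorem hubs_run_succ_of_opens {t : ℕ} (h : (run ok r x t).Opens ok (x t)) :
    (run ok r x (t + 1)).hubs = (run ok r x t).hubs ++ [x t] := by
  rw [run, step]; simp [h]

theorem run_succ_of_not_opens {t : ℕ} (h : ¬ (run ok r x t).Opens ok (x t)) :
    (run ok r x (t + 1)).hubs = (run ok r x t).hubs ∧
    (run ok r x (t + 1)).scale = (run ok r x t).scale ∧
    (run ok r x (t + 1)).parent = (run ok r x t).parent := by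
  rw [run, step]; simp [h]

theorem hubs_prefix {s t : ℕ} (h : s ≤ t) : (run ok r x s).hubs <+: (run ok r x t).hubs := by
  induction t, h using Nat.le_induction with
  | base => exact List.prefix_rfl
  | succ t _ ih =>
    refine ih.trans ?_
    by_cases ho : (run ok r x t).Opens ok (x t)
    · rw [hubs_run_succ_of_opens ok r x ho]; exact List.prefix_append _ _
    · rw [(run_succ_of_not_opens ok r x ho).1]

theorem root_mem_hubs (t : ℕ) : r ∈ (run ok r x t).hubs :=
  (hubs_prefix ok r x (Nat.zero_le t)).subset (by simp [run, initial])

theorem gap_run_anti {s t : ℕ} (h : s ≤ t) (y : X) :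
    (run ok r x t).gap y ≤ (run ok r x s).gap y :=
  Metric.infDist_le_infDist_of_subset (fun _ hz => (hubs_prefix ok r x h).subset hz)
    ⟨r, root_mem_hubs ok r x s⟩

theorem scale_parent_run_succ {t : ℕ} {u : X} (hu : u ∈ (run ok r x t).hubs) :
    (run ok r x (t + 1)).scale u = (run ok r x t).scale u ∧
    (run ok r x (t + 1)).parent u = (run ok r x t).parent u := by
  by_cases ho : (run ok r x t).Opens ok (x t)
  · have hne : u ≠ x t := fun h =>
      (gap_pos_iff (root_mem_hubs ok r x t)).1 ho.1 (h ▸ hu)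
    rw [run, step]; simp [ho, hne]
  · rw [(run_succ_of_not_opens ok r x ho).2.1, (run_succ_of_not_opens ok r x ho).2.2]
    exact ⟨rfl, rfl⟩

theorem scale_parent_run {s t : ℕ} (h : s ≤ t) {u : X} (hu : u ∈ (run ok r x s).hubs) :
    (run ok r x t).scale u = (run ok r x s).scale u ∧
    (run ok r x t).parent u = (run ok r x s).parent u := by
  induction t, h using Nat.le_induction with
  | base => exact ⟨rfl, rfl⟩
  | succ t hst ih =>
    have := scale_parent_run_succ ok r x ((hubs_prefix ok r x hst).subset hu)
    exact ⟨this.1.trans ih.1, this.2.trans ih.2⟩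

theorem count_run (t : ℕ) (y : X) (j : ℤ) :
    (run ok r x t).count y j = ((Finset.range t).filter fun s =>
      0 < (run ok r x s).gap (x s) ∧ (run ok r x s).cls (x s) = j ∧
        dist y (x s) ≤ 2 ^ j / 8).card := by
  rw [Finset.card_filter]
  induction t with
  | zero => rfl
  | succ t ih => rw [Finset.sum_range_succ, ← ih]; rfl

/-- The properties of a newly opened hub. -/
theorem opened_spec {t : ℕ} (ho : (run ok r x t).Opens ok (x t)) :
    (run ok r x (t + 1)).parent (x t) ∈ (run ok r x t).hubs ∧
    ((run ok r x (t + 1)).parent (x t) = r ∨ (run ok r x (t + 1)).scale (x t) <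
      (run ok r x t).scale ((run ok r x (t + 1)).parent (x t))) ∧
    dist (x t) ((run ok r x (t + 1)).parent (x t)) ≤ 2 ^ (run ok r x (t + 1)).scale (x t) ∧
    ∀ w j, (run ok r x t).Covers r (x t) w j → (run ok r x (t + 1)).scale (x t) ≤ j := by
  have h1 : (run ok r x (t + 1)).parent (x t) = ((run ok r x t).link r (x t)).1 := by
    rw [run, step]; simp [ho]
  have h2 : (run ok r x (t + 1)).scale (x t) = ((run ok r x t).link r (x t)).2 := by
    rw [run, step]; simp [ho]
  obtain ⟨⟨h3, h4, h5⟩, h6⟩ := link_spec (root_mem_hubs ok r x t) ho.1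
  rw [h1, h2]
  exact ⟨h3, h4, h5, h6⟩

/-- A hub other than the root is opened by some terminal. -/
theorem exists_opens_of_mem_hubs {t : ℕ} {u : X} (hu : u ∈ (run ok r x t).hubs) (hur : u ≠ r) :
    ∃ s < t, (run ok r x s).Opens ok (x s) ∧ x s = u := by
  induction t with
  | zero => simp [run, initial, hur] at hu
  | succ t ih =>
    by_cases ho : (run ok r x t).Opens ok (x t)
    · rw [hubs_run_succ_of_opens ok r x ho, List.mem_append, List.mem_singleton] at hu
      rcases hu with hu | hu
      · obtain ⟨s, hs, h⟩ := ih hu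
        exact ⟨s, by omega, h⟩
      · exact ⟨t, by omega, ho, hu.symm⟩
    · rw [(run_succ_of_not_opens ok r x ho).1] at hu
      obtain ⟨s, hs, h⟩ := ih hu
      exact ⟨s, by omega, h⟩

theorem mem_hubs_of_opens {s t : ℕ} (hst : s < t) (ho : (run ok r x s).Opens ok (x s)) :
    x s ∈ (run ok r x t).hubs :=
  (hubs_prefix ok r x (show s + 1 ≤ t from hst)).subset
    (by rw [hubs_run_succ_of_opens ok r x ho]; simp)

theorem dist_parent_le {t : ℕ} {u : X} (hu : u ∈ (run ok r x t).hubs) (hur : u ≠ r) :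
    dist u ((run ok r x t).parent u) ≤ 2 ^ (run ok r x t).scale u := by
  obtain ⟨s, hs, ho, rfl⟩ := exists_opens_of_mem_hubs ok r x hu hur
  obtain ⟨h1, h2⟩ := scale_parent_run ok r x (show s + 1 ≤ t from hs)
    (mem_hubs_of_opens ok r x (Nat.lt_succ_self s) ho)
  rw [h1, h2]
  exact (opened_spec ok r x ho).2.2.1

theorem two_zpow_scale_lt_dist_root {t : ℕ} {u : X} (hu : u ∈ (run ok r x t).hubs) (hur : u ≠ r) :
    2 ^ (run ok r x t).scale u < 2 * dist u r := by
  obtain ⟨s, hs, ho, rfl⟩ := exists_opens_of_mem_hubs ok r x hu hur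
  rw [(scale_parent_run ok r x (show s + 1 ≤ t from hs)
    (mem_hubs_of_opens ok r x (Nat.lt_succ_self s) ho)).1]
  by_contra! h
  have := (opened_spec ok r x ho).2.2.2 r ((run ok r x (s + 1)).scale (x s) - 1)
    ⟨root_mem_hubs ok r x s, Or.inl rfl, by rw [zpow_sub_one₀ (by norm_num)]; linarith⟩
  omega

/-- Hubs of the same scale are separated. -/
theorem two_zpow_scale_lt_dist {t : ℕ} {u w : X} (hu : u ∈ (run ok r x t).hubs) (hur : u ≠ r)
    (hw : w ∈ (run ok r x t).hubs) (hwr : w ≠ r) (huw : u ≠ w)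
    (h : (run ok r x t).scale u = (run ok r x t).scale w) :
    2 ^ (run ok r x t).scale u < 2 * dist u w := by
  obtain ⟨s, hs, ho, rfl⟩ := exists_opens_of_mem_hubs ok r x hu hur
  obtain ⟨s', hs', ho', rfl⟩ := exists_opens_of_mem_hubs ok r x hw hwr
  wlog hlt : s' < s generalizing s s'
  · have hne : s ≠ s' := fun h => huw (by rw [h])
    have := this s' hs' ho' hw hwr s hs ho hu hur huw.symm h.symm (by omega)
    rwa [dist_comm, ← h] at this
  have e1 := (scale_parent_run ok r x (show s + 1 ≤ t from hs)
    (mem_hubs_of_opens ok r x (Nat.lt_succ_self s) ho)).1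
  have e2 := (scale_parent_run ok r x hs.le (mem_hubs_of_opens ok r x hlt ho')).1
  rw [e1, e2] at h
  rw [e1]
  by_contra! hle
  have := (opened_spec ok r x ho).2.2.2 (x s') ((run ok r x (s + 1)).scale (x s) - 1)
    ⟨mem_hubs_of_opens ok r x hlt ho', Or.inr (by omega), by
      rw [zpow_sub_one₀ (by norm_num)]; linarith⟩
  omega

/-- Every hub has enough terminals nearby. -/
theorem exists_terminals_near_hub {t : ℕ} {u : X} (hu : u ∈ (run ok r x t).hubs) (hur : u ≠ r) :
    ∃ P ⊆ Finset.range t, P.Nonempty ∧ ok P.card ∧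
      ∀ s ∈ P, dist u (x s) ≤ 2 ^ (run ok r x t).scale u / 8 := by
  obtain ⟨s, hs, ho, rfl⟩ := exists_opens_of_mem_hubs ok r x hu hur
  rw [(scale_parent_run ok r x (show s + 1 ≤ t from hs)
    (mem_hubs_of_opens ok r x (Nat.lt_succ_self s) ho)).1]
  have hle : (2 : ℝ) ^ (run ok r x s).cls (x s) ≤ 2 ^ (run ok r x (s + 1)).scale (x s) := by
    obtain ⟨h1, _, h3, _⟩ := opened_spec ok r x ho
    exact (two_zpow_cls_le ho.1).trans ((gap_le_dist h1 _).trans h3)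
  refine ⟨insert s ((Finset.range s).filter fun s' =>
      0 < (run ok r x s').gap (x s') ∧ (run ok r x s').cls (x s') = (run ok r x s).cls (x s) ∧
        dist (x s) (x s') ≤ 2 ^ (run ok r x s).cls (x s) / 8),
    ?_, Finset.insert_nonempty _ _, ?_, ?_⟩
  · intro s' hs'
    simp only [Finset.mem_insert, Finset.mem_filter, Finset.mem_range] at hs' ⊢
    omega
  · rw [Finset.card_insert_of_notMem (by simp), ← count_run]
    exact ho.2
  · intro s' hs'
    simp only [Finset.mem_insert, Finset.mem_filter] at hs'
    rcases hs' with rfl | hs'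
    · rw [dist_self]; positivity
    · linarith [hs'.2.2.2]

variable {ok} in
/-- Few terminals of the same class are close together. -/
theorem not_ok_card_sub_one (hok : ∀ a b, a ≤ b → ok a → ok b) (j : ℤ) (B : Finset ℕ)
    (hB : ∀ s ∈ B, 0 < (run ok r x s).gap (x s) ∧ (run ok r x s).cls (x s) = j)
    (hd : ∀ s ∈ B, ∀ s' ∈ B, dist (x s) (x s') ≤ 2 ^ j / 8) (hcard : 1 < B.card) :
    ¬ ok (B.card - 1) := by
  intro hk
  have hne : B.Nonempty := Finset.card_pos.1 (by omega)
  set t₂ := B.max' hne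
  have ht₂ : t₂ ∈ B := Finset.max'_mem _ _
  have hne' : (B.erase t₂).Nonempty :=
    Finset.card_pos.1 (by rw [Finset.card_erase_of_mem ht₂]; omega)
  set t₁ := (B.erase t₂).max' hne'
  have ht₁' : t₁ ∈ B.erase t₂ := Finset.max'_mem _ _
  have ht₁ : t₁ ∈ B := Finset.mem_of_mem_erase ht₁'
  have hlt : t₁ < t₂ := lt_of_le_of_ne (Finset.le_max' _ _ ht₁) (Finset.ne_of_mem_erase ht₁')
  have hopen : (run ok r x t₁).Opens ok (x t₁) := by
    refine ⟨(hB t₁ ht₁).1, hok _ _ ?_ hk⟩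
    rw [count_run, (hB t₁ ht₁).2]
    have hsub : (B.erase t₂).erase t₁ ⊆ (Finset.range t₁).filter fun s =>
        0 < (run ok r x s).gap (x s) ∧ (run ok r x s).cls (x s) = j ∧
          dist (x t₁) (x s) ≤ 2 ^ j / 8 := by
      intro s hs
      have hs' := Finset.mem_of_mem_erase hs
      have hsB := Finset.mem_of_mem_erase hs'
      rw [Finset.mem_filter, Finset.mem_range]
      exact ⟨lt_of_le_of_ne (Finset.le_max' _ _ hs') (Finset.ne_of_mem_erase hs),
        (hB s hsB).1, (hB s hsB).2, hd _ ht₁ _ hsB⟩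
    have := Finset.card_le_card hsub
    rw [Finset.card_erase_of_mem ht₁', Finset.card_erase_of_mem ht₂] at this
    omega
  have h1 := gap_le_dist (mem_hubs_of_opens ok r x hlt hopen) (x t₂)
  have h2 := two_zpow_cls_le (hB t₂ ht₂).1
  rw [(hB t₂ ht₂).2] at h2
  have h3 := hd _ ht₂ _ ht₁
  have : (0 : ℝ) < 2 ^ j := by positivity
  linarith

/-- Climbing the tree of hubs until the root or a hub of large scale is reached. -/
theorem exists_climb (t : ℕ) {u : X} (hu : u ∈ (run ok r x t).hubs) (a : ℝ) (ha : 0 ≤ a) :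
    ∃ w ∈ (run ok r x t).hubs, ∃ p, IsPath u w p ∧ (w = r ∨ a ≤ 2 ^ (run ok r x t).scale w) ∧
      (∀ e ∈ edgeList p, ∃ u' ∈ (run ok r x t).hubs, u' ≠ r ∧
        e = s(u', (run ok r x t).parent u')) ∧
      pathLen p ≤ 2 * a ∧
      (u ≠ r → 2 ^ (run ok r x t).scale u < a →
        pathLen p ≤ 2 * a - 2 ^ (run ok r x t).scale u) := by
  have stay : ∀ t u, u ∈ (run ok r x t).hubs → (u = r ∨ a ≤ 2 ^ (run ok r x t).scale u) →
      ∃ w ∈ (run ok r x t).hubs, ∃ p, IsPath u w p ∧ (w = r ∨ a ≤ 2 ^ (run ok r x t).scale w) ∧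
      (∀ e ∈ edgeList p, ∃ u' ∈ (run ok r x t).hubs, u' ≠ r ∧
        e = s(u', (run ok r x t).parent u')) ∧
      pathLen p ≤ 2 * a ∧
      (u ≠ r → 2 ^ (run ok r x t).scale u < a →
        pathLen p ≤ 2 * a - 2 ^ (run ok r x t).scale u) := by
    intro t u hu h
    refine ⟨u, hu, [u], isPath_singleton u, h, by simp [edgeList_singleton], ?_, ?_⟩
    · rw [pathLen_singleton]; positivity
    · intro h1 h2
      rcases h with h | h
      · exact absurd h h1
      · linarith
  induction t generalizing u with
  | zero =>
    refine stay 0 u hu (Or.inl ?_)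
    simpa [run, initial] using hu
  | succ t ih =>
    have hsub := (hubs_prefix ok r x (Nat.le_succ t)).subset
    by_cases hut : u ∈ (run ok r x t).hubs
    · obtain ⟨w, hw, p, h1, h2, h3, h4, h5⟩ := ih hut
      rw [(scale_parent_run_succ ok r x hut).1]
      refine ⟨w, hsub hw, p, h1, ?_, ?_, h4, h5⟩
      · rwa [(scale_parent_run_succ ok r x hw).1]
      · intro e he
        obtain ⟨u', hu', h6, h7⟩ := h3 e he
        exact ⟨u', hsub hu', h6, by rw [h7, (scale_parent_run_succ ok r x hu').2]⟩
    · have ho : (run ok r x t).Opens ok (x t) := by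
        by_contra ho
        rw [(run_succ_of_not_opens ok r x ho).1] at hu
        exact hut hu
      obtain rfl : u = x t := by
        rw [hubs_run_succ_of_opens ok r x ho, List.mem_append, List.mem_singleton] at hu
        exact hu.resolve_left hut
      have hur : x t ≠ r := fun h => hut (h ▸ root_mem_hubs ok r x t)
      by_cases h_scale : a ≤ 2 ^ (run ok r x (t + 1)).scale (x t)
      · exact stay _ _ hu (Or.inr h_scale)
      push Not at h_scale
      obtain ⟨g1, g2, g3, -⟩ := opened_spec ok r x ho
      have edge : ∀ {w p}, IsPath ((run ok r x (t + 1)).parent (x t)) w p →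
          (∀ e ∈ edgeList p, ∃ u' ∈ (run ok r x t).hubs, u' ≠ r ∧
            e = s(u', (run ok r x t).parent u')) →
          (∀ e ∈ edgeList (x t :: p), ∃ u' ∈ (run ok r x (t + 1)).hubs, u' ≠ r ∧
            e = s(u', (run ok r x (t + 1)).parent u')) ∧
          pathLen (x t :: p) ≤ 2 ^ (run ok r x (t + 1)).scale (x t) + pathLen p := by
        intro w p hp h3
        constructor
        · intro e he
          rw [edgeList_cons hp, List.mem_cons] at he
          rcases he with rfl | he
          · exact ⟨x t, hu, hur, rfl⟩
          · obtain ⟨u', hu', h6, h7⟩ := h3 e he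
            exact ⟨u', hsub hu', h6, by rw [h7, (scale_parent_run_succ ok r x hu').2]⟩
        · have e1 : edgeList (x t :: p) =
              edgeList [x t, (run ok r x (t + 1)).parent (x t)] ++ edgeList p := by
            rw [edgeList_cons hp, edgeList_cons (isPath_singleton _), edgeList_singleton]; rfl
          refine (pathLen_le_of_edgeList_eq e1).trans ?_
          have : pathLen [x t, (run ok r x (t + 1)).parent (x t)] =
              dist (x t) ((run ok r x (t + 1)).parent (x t)) := by
            rw [pathLen, edgeList_cons (isPath_singleton _), edgeList_singleton]
            simp [edgeLen]
          linarith
      by_cases hp : (run ok r x (t + 1)).parent (x t) = r ∨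
          a ≤ 2 ^ (run ok r x t).scale ((run ok r x (t + 1)).parent (x t))
      · have hq := isPath_singleton ((run ok r x (t + 1)).parent (x t))
        obtain ⟨h6, h7⟩ := edge hq (by simp [edgeList_singleton])
        rw [pathLen_singleton] at h7
        refine ⟨_, hsub g1, _, isPath_cons hq, ?_, h6, by linarith, fun _ _ => by linarith⟩
        rwa [(scale_parent_run_succ ok r x g1).1]
      · push Not at hp
        obtain ⟨w, hw, p, h1, h2, h3, h4, h5⟩ := ih g1
        obtain ⟨h6, h7⟩ := edge h1 h3
        have h8 := h5 hp.1 hp.2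
        have h9 : (2 : ℝ) ^ ((run ok r x (t + 1)).scale (x t) + 1) ≤
            2 ^ (run ok r x t).scale ((run ok r x (t + 1)).parent (x t)) :=
          zpow_le_zpow_right₀ (by norm_num) (g2.resolve_left hp.1)
        rw [zpow_add_one₀ (by norm_num)] at h9
        refine ⟨w, hsub hw, _, isPath_cons h1, ?_, h6, ?_, fun _ _ => by linarith⟩
        · rwa [(scale_parent_run_succ ok r x hw).1]
        · have : (0 : ℝ) < 2 ^ (run ok r x (t + 1)).scale (x t) := by positivity
          linarith

end run

end HubState

theorem sum_biUnion_le {ι α : Type*} [DecidableEq α] {f : α → ℝ} (hf : ∀ a, 0 ≤ f a)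
    (s : Finset ι) (g : ι → Finset α) :
    ∑ a ∈ s.biUnion g, f a ≤ ∑ i ∈ s, ∑ a ∈ g i, f a := by
  induction s using Finset.induction_on with
  | empty => simp
  | insert i s hi ih =>
    rw [Finset.biUnion_insert, Finset.sum_insert hi]
    have h := Finset.sum_union_inter (s₁ := g i) (s₂ := s.biUnion g) (f := f)
    have : 0 ≤ ∑ a ∈ g i ∩ s.biUnion g, f a := Finset.sum_nonneg fun a _ => hf a
    linarith

namespace HubState

/-- The hubs of the second state to which the hub `w` of the first state is connected. -/
def targets (S S' : HubState X) (w : X) : Finset X :=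
  S'.hubs.toFinset.filter fun z =>
    ∃ j : ℤ, j ≤ S.scale w + 1 ∧ S'.hubs.find? (fun y => dist w y < 2 ^ (j + 1)) = some z

/-- The edges joining the hubs of the first state to their parents and to hubs of the second. -/
def net (r : X) (S S' : HubState X) : Finset (Sym2 X) :=
  (S.hubs.toFinset.erase r).biUnion fun w =>
    insert s(w, S.parent w) ((S.targets S' w).image fun z => s(w, z))

theorem sum_dist_targets_le (S S' : HubState X) (w : X) :
    ∑ z ∈ S.targets S' w, dist w z ≤ 8 * 2 ^ S.scale w := by
  have h : ∀ z : X, ∃ j : ℤ, z ∈ S.targets S' w → j ≤ S.scale w + 1 ∧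
      S'.hubs.find? (fun y => dist w y < 2 ^ (j + 1)) = some z := by
    intro z
    by_cases hz : z ∈ S.targets S' w
    · obtain ⟨j, hj⟩ := (Finset.mem_filter.1 hz).2
      exact ⟨j, fun _ => hj⟩
    · exact ⟨0, fun h => absurd h hz⟩
  choose J hJ using h
  have hinj : Set.InjOn (fun z => J z + 1) (S.targets S' w : Set X) := by
    intro z hz z' hz' hzz
    have h1 := (hJ z hz).2
    have h2 := (hJ z' hz').2
    have h3 : J z = J z' := by simpa using hzz
    rw [h3, h2] at h1
    exact (Option.some.inj h1).symm
  calc ∑ z ∈ S.targets S' w, dist w z ≤ ∑ z ∈ S.targets S' w, (2 : ℝ) ^ (J z + 1) := by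
        refine Finset.sum_le_sum fun z hz => ?_
        have := List.find?_some (hJ z hz).2
        exact (by simpa using this : dist w z < _).le
    _ = ∑ j ∈ (S.targets S' w).image fun z => J z + 1, (2 : ℝ) ^ j :=
        (Finset.sum_image (f := fun j : ℤ => (2 : ℝ) ^ j) hinj).symm
    _ ≤ 2 ^ (S.scale w + 2 + 1) := by
        refine sum_two_zpow_le _ _ fun j hj => ?_
        obtain ⟨z, hz, rfl⟩ := Finset.mem_image.1 hj
        have := (hJ z hz).1
        omega
    _ = 8 * 2 ^ S.scale w := by
        rw [add_assoc, zpow_add₀ (by norm_num)]; norm_num; ring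

section run

variable (ok ok' : ℕ → Prop) (r : X) (x : ℕ → X)

theorem sum_edgeLen_net_le (t : ℕ) :
    ∑ e ∈ net r (run ok r x t) (run ok' r x t), edgeLen e ≤
      9 * ∑ u ∈ (run ok r x t).hubs.toFinset.erase r, (2 : ℝ) ^ (run ok r x t).scale u := by
  rw [net, Finset.mul_sum]
  refine (sum_biUnion_le edgeLen_nonneg _ _).trans (Finset.sum_le_sum fun u hu => ?_)
  rw [Finset.mem_erase, List.mem_toFinset] at hu
  have h1 : edgeLen s(u, (run ok r x t).parent u) ≤ 2 ^ (run ok r x t).scale u :=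
    dist_parent_le ok r x hu.2 hu.1
  have h2 := sum_dist_targets_le (run ok r x t) (run ok' r x t) u
  have h3 := Finset.sum_image_le_of_nonneg (s := (run ok r x t).targets (run ok' r x t) u)
    (g := fun z => s(u, z)) (f := edgeLen) fun e _ => edgeLen_nonneg e
  rw [Finset.insert_eq]
  have h4 := Finset.sum_union_inter (s₁ := {s(u, (run ok r x t).parent u)})
    (s₂ := ((run ok r x t).targets (run ok' r x t) u).image fun z => s(u, z)) (f := edgeLen)
  have h5 : 0 ≤ ∑ e ∈ {s(u, (run ok r x t).parent u)} ∩
      ((run ok r x t).targets (run ok' r x t) u).image fun z => s(u, z), edgeLen e :=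
    Finset.sum_nonneg fun e _ => edgeLen_nonneg e
  rw [Finset.sum_singleton] at h4
  change _ ≤ ∑ z ∈ (run ok r x t).targets (run ok' r x t) u, dist u z at h3
  linarith

theorem net_mono {s t : ℕ} (h : s ≤ t) :
    net r (run ok r x s) (run ok' r x s) ⊆ net r (run ok r x t) (run ok' r x t) := by
  intro e he
  simp only [net, targets, Finset.mem_biUnion, Finset.mem_insert, Finset.mem_image,
    Finset.mem_filter, Finset.mem_erase, List.mem_toFinset] at he ⊢
  obtain ⟨w, ⟨hwr, hw⟩, he⟩ := he
  have hw' := (hubs_prefix ok r x h).subset hw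
  obtain ⟨h1, h2⟩ := scale_parent_run ok r x h hw
  refine ⟨w, ⟨hwr, hw'⟩, ?_⟩
  rcases he with he | ⟨z, ⟨hz, j, hj, hf⟩, he⟩
  · exact Or.inl (by rw [h2, he])
  · refine Or.inr ⟨z, ⟨(hubs_prefix ok' r x h).subset hz, j, by rwa [h1], ?_⟩, he⟩
    obtain ⟨l, hl⟩ := hubs_prefix ok' r x h
    rw [← hl, List.find?_append, hf]
    rfl

/-- Every hub of one level is joined to a hub of the other level by a short path. -/
theorem exists_path_net (t : ℕ) {u : X} (hu : u ∈ (run ok r x t).hubs) :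
    ∃ z ∈ (run ok' r x t).hubs, ∃ p, IsPath u z p ∧
      (∀ e ∈ edgeList p, e ∈ net r (run ok r x t) (run ok' r x t)) ∧
      pathLen p ≤ 8 * (run ok' r x t).gap u := by
  set S := run ok r x t
  set S' := run ok' r x t
  have ha : 0 ≤ S'.gap u := S'.gap_nonneg u
  have hr' : r ∈ S'.hubs := root_mem_hubs ok' r x t
  obtain ⟨w, hw, p, hp, h_scale, hedge, hlen, -⟩ := exists_climb ok r x t hu _ ha
  have hnet : ∀ e ∈ edgeList p, e ∈ net r S S' := by
    intro e he
    obtain ⟨u', hu', hur, rfl⟩ := hedge e he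
    exact Finset.mem_biUnion.2 ⟨u', Finset.mem_erase.2 ⟨hur, List.mem_toFinset.2 hu'⟩,
      Finset.mem_insert_self _ _⟩
  by_cases hw' : w ∈ S'.hubs
  · exact ⟨w, hw', p, hp, hnet, by linarith⟩
  have hwr : w ≠ r := fun h => hw' (h ▸ hr')
  have hgap : 0 < S'.gap w := (gap_pos_iff hr').2 hw'
  have hgap3 : S'.gap w ≤ 3 * S'.gap u := by
    have := S'.gap_le_gap_add_dist w u
    rw [dist_comm] at this
    linarith [hp.dist_le]
  have hscale := h_scale.resolve_left hwr
  have hj1 := two_zpow_cls_le hgap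
  have hj2 := S'.gap_lt_two_zpow_cls w
  have hj : S'.cls w ≤ S.scale w + 1 := by
    have : (2 : ℝ) ^ S'.cls w < 2 ^ (S.scale w + 2) := by
      rw [zpow_add₀ (by norm_num)]
      have : (0 : ℝ) < 2 ^ S.scale w := by positivity
      norm_num
      linarith
    have := (zpow_lt_zpow_iff_right₀ (by norm_num : (1 : ℝ) < 2)).1 this
    omega
  obtain ⟨y, hy, hdy⟩ := exists_gap_eq_dist hr' w
  obtain ⟨z, hz⟩ : ∃ z, S'.hubs.find? (fun y => dist w y < 2 ^ (S'.cls w + 1)) = some z := by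
    rw [← Option.isSome_iff_exists, List.find?_isSome]
    exact ⟨y, hy, by simpa [hdy] using hj2⟩
  have hz' := List.mem_of_find?_eq_some hz
  have hdz : dist w z < 2 ^ (S'.cls w + 1) := by simpa using List.find?_some hz
  obtain ⟨p', hp', he⟩ := hp.trans (isPath_cons (a := w) (isPath_singleton z))
  refine ⟨z, hz', p', hp', ?_, ?_⟩
  · intro e he'
    rw [he, List.mem_append, edgeList_cons (isPath_singleton z), edgeList_singleton,
      List.mem_singleton] at he'
    rcases he' with he' | rfl
    · exact hnet e he'
    · exact Finset.mem_biUnion.2 ⟨w, Finset.mem_erase.2 ⟨hwr, List.mem_toFinset.2 hw⟩,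
        Finset.mem_insert_of_mem (Finset.mem_image.2 ⟨z, Finset.mem_filter.2
          ⟨List.mem_toFinset.2 hz', S'.cls w, hj, hz⟩, rfl⟩)⟩
  · have h1 := pathLen_le_of_edgeList_eq he
    have h2 : pathLen [w, z] = dist w z := by
      rw [pathLen, edgeList_cons (isPath_singleton _), edgeList_singleton]
      simp [edgeLen]
    rw [zpow_add_one₀ (by norm_num)] at hdz
    linarith

end run

end HubState

theorem sixteen_mul_sum_le {m : ℕ} {b : ℕ → ℝ} (hb0 : ∀ l, 0 ≤ b l)
    (hb : ∀ l, l + 1 < m → 32 * b (l + 1) ≤ b l) (l : ℕ) (hl : l < m) :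
    16 * ∑ i ∈ Finset.Ico (l + 1) m, b i ≤ b l := by
  induction h : m - l generalizing l with
  | zero => omega
  | succ n ih =>
    rcases Nat.lt_or_ge (l + 1) m with hlt | hge
    · have h1 := ih (l + 1) hlt (by omega)
      rw [Finset.sum_eq_sum_Ico_succ_bot hlt]
      linarith [hb l hlt, hb0 (l + 1)]
    · rw [Finset.Ico_eq_empty (by omega)]
      simpa using hb0 l

namespace HubState

/-- Short paths between consecutive levels combine to a cheap path to the root. -/
theorem exists_path_root {r : X} {m : ℕ} (S : ℕ → HubState X) (hroot : (S m).hubs = [r])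
    (hpath : ∀ l < m, ∀ u ∈ (S l).hubs, ∃ z ∈ (S (l + 1)).hubs, ∃ p, IsPath u z p ∧
      (∀ e ∈ edgeList p, e ∈ net r (S l) (S (l + 1))) ∧ pathLen p ≤ 8 * (S (l + 1)).gap u)
    {b : ℕ → ℝ} (hb0 : ∀ l, 0 ≤ b l) (hb : ∀ l, l + 1 < m → 32 * b (l + 1) ≤ b l)
    (l : ℕ) (hl : l ≤ m) (u : X) (hu : u ∈ (S l).hubs) :
    ∃ (p : List X) (ty : Sym2 X → ℕ), IsPath u r p ∧
      (∀ e ∈ edgeList p, ty e < m ∧ e ∈ net r (S (ty e)) (S (ty e + 1))) ∧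
      ∑ e ∈ (edgeList p).toFinset, b (ty e) * edgeLen e ≤
        16 * ∑ i ∈ Finset.Ico l m, b i * (S (i + 1)).gap u := by
  induction h : m - l generalizing l u with
  | zero =>
    obtain rfl : l = m := by omega
    rw [hroot, List.mem_singleton] at hu
    exact ⟨[u], fun _ => 0, hu ▸ isPath_singleton u, by simp [edgeList_singleton],
      by simp [edgeList_singleton]⟩
  | succ n ih =>
    have hlm : l < m := by omega
    obtain ⟨z, hz, p₀, hp₀, hnet, hlen⟩ := hpath l hlm u hu
    obtain ⟨p₁, ty, hp₁, hty, hcost⟩ := ih (l + 1) hlm z hz (by omega)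
    obtain ⟨p, hp, he⟩ := hp₀.trans hp₁
    refine ⟨p, fun e => if e ∈ edgeList p₀ then l else ty e, hp, ?_, ?_⟩
    · intro e he'
      beta_reduce
      split_ifs with h0
      · exact ⟨hlm, hnet e h0⟩
      · rw [he, List.mem_append] at he'
        exact hty e (he'.resolve_left h0)
    · have h1 : ∑ e ∈ (edgeList p).toFinset,
          b (if e ∈ edgeList p₀ then l else ty e) * edgeLen e ≤
          b l * pathLen p₀ + ∑ e ∈ (edgeList p₁).toFinset, b (ty e) * edgeLen e := by
        rw [he, List.toFinset_append, ← Finset.union_sdiff_self_eq_union,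
          Finset.sum_union Finset.disjoint_sdiff, pathLen, Finset.mul_sum]
        refine add_le_add (Finset.sum_le_sum fun e h => ?_)
          ((Finset.sum_le_sum fun e h => ?_).trans
            (Finset.sum_le_sum_of_subset_of_nonneg Finset.sdiff_subset
              fun e _ _ => mul_nonneg (hb0 _) (edgeLen_nonneg e)))
        · rw [if_pos (List.mem_toFinset.1 h)]
        · rw [if_neg fun h' => (Finset.mem_sdiff.1 h).2 (List.mem_toFinset.2 h')]
      have h2 : ∑ i ∈ Finset.Ico (l + 1) m, b i * (S (i + 1)).gap z ≤
          ∑ i ∈ Finset.Ico (l + 1) m, b i * (S (i + 1)).gap u +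
          (∑ i ∈ Finset.Ico (l + 1) m, b i) * pathLen p₀ := by
        rw [Finset.sum_mul, ← Finset.sum_add_distrib]
        refine Finset.sum_le_sum fun i _ => ?_
        rw [← mul_add]
        refine mul_le_mul_of_nonneg_left ?_ (hb0 i)
        have := (S (i + 1)).gap_le_gap_add_dist z u
        rw [dist_comm] at this
        linarith [hp₀.dist_le]
      have h3 := mul_le_mul_of_nonneg_right (sixteen_mul_sum_le hb0 hb l hlm) (pathLen_nonneg p₀)
      have h4 := mul_le_mul_of_nonneg_left hlen (hb0 l)
      rw [Finset.sum_eq_sum_Ico_succ_bot hlm]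
      linarith

/-- The number of terminals at which level `l` opens a hub: buying costs `s l`, and reaching a hub
of level `l` costs `g l` per terminal. Level `m` consists of the root only. -/
def Threshold (m : ℕ) (s g : ℕ → ℝ) (l n : ℕ) : Prop := l < m ∧ s l ≤ g l * n

/-- The state of level `l` after `t` terminals. -/
def level (m : ℕ) (s g : ℕ → ℝ) (r : X) (x : ℕ → X) (t l : ℕ) : HubState X :=
  run (Threshold m s g l) r x t

theorem hubs_level_top (m : ℕ) (s g : ℕ → ℝ) (r : X) (x : ℕ → X) (t : ℕ) :
    (level m s g r x t m).hubs = [r] := by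
  induction t with
  | zero => rfl
  | succ t ih =>
    rw [level, (run_succ_of_not_opens _ r x fun h => lt_irrefl _ h.2.1).1]
    exact ih

theorem mem_hubs_level_zero {m : ℕ} (hm : 1 ≤ m) {s g : ℕ → ℝ} (hg : 0 ≤ g 0) (h0 : s 0 = g 0)
    (r : X) (x : ℕ → X) (t : ℕ) : x t ∈ (level m s g r x (t + 1) 0).hubs := by
  by_cases ho : (level m s g r x t 0).Opens (Threshold m s g 0) (x t)
  · exact mem_hubs_of_opens _ r x (Nat.lt_succ_self t) ho
  · refine (hubs_prefix _ r x (Nat.le_succ t)).subset ?_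
    by_contra hx
    refine ho ⟨(gap_pos_iff (root_mem_hubs _ r x t)).2 hx, hm, ?_⟩
    rw [h0]
    push_cast
    have := mul_nonneg hg (Nat.cast_nonneg (α := ℝ)
      ((level m s g r x t 0).count (x t) ((level m s g r x t 0).cls (x t))))
    linarith

/-- The newest terminal reaches the root along the nets of the levels. -/
theorem exists_route {m : ℕ} (hm : 1 ≤ m) {s g : ℕ → ℝ} (hg : ∀ l, 0 ≤ g l) (h0 : s 0 = g 0)
    (hdec : ∀ l, l + 1 < m → 32 * g (l + 2) ≤ g (l + 1)) (r : X) (x : ℕ → X) (t : ℕ) :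
    ∃ (p : List X) (ty : Sym2 X → ℕ), IsPath (x t) r p ∧
      (∀ e ∈ edgeList p, ty e < m ∧
        e ∈ net r (level m s g r x (t + 1) (ty e)) (level m s g r x (t + 1) (ty e + 1))) ∧
      ∑ e ∈ (edgeList p).toFinset, g (ty e + 1) * edgeLen e ≤
        16 * ∑ i ∈ Finset.range m, g (i + 1) * (level m s g r x t (i + 1)).gap (x t) := by
  obtain ⟨p, ty, h1, h2, h3⟩ := exists_path_root (level m s g r x (t + 1))
    (hubs_level_top m s g r x (t + 1))
    (fun l _ u hu => exists_path_net _ _ r x (t + 1) hu) (b := fun l => g (l + 1))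
    (fun l => hg _) hdec 0 (Nat.zero_le m) (x t) (mem_hubs_level_zero hm (hg 0) h0 r x t)
  refine ⟨p, ty, h1, h2, h3.trans ?_⟩
  rw [← Finset.range_eq_Ico]
  gcongr with i _
  · exact hg _
  · exact gap_run_anti _ r x (Nat.le_succ t) (x t)

end HubState

namespace HubState

/-- The cost per unit length that level `l` charges to an edge of load `n`. -/
def capacity (m : ℕ) (s g : ℕ → ℝ) (l n : ℕ) : ℝ :=
  if l < m then min (g l * n) (s l) else g l * n

theorem capacity_nonneg {m : ℕ} {s g : ℕ → ℝ} (hs : ∀ l, 0 ≤ s l) (hg : ∀ l, 0 ≤ g l) (l n : ℕ) :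
    0 ≤ capacity m s g l n := by
  have := mul_nonneg (hg l) (Nat.cast_nonneg (α := ℝ) n)
  unfold capacity
  split_ifs
  · exact le_min this (hs l)
  · exact this

theorem Threshold.mono {m : ℕ} {s g : ℕ → ℝ} {l a b : ℕ} (hg : 0 ≤ g l) (hab : a ≤ b)
    (h : Threshold m s g l a) : Threshold m s g l b :=
  ⟨h.1, h.2.trans (mul_le_mul_of_nonneg_left (by exact_mod_cast hab) hg)⟩

section charging

variable {m : ℕ} {s g : ℕ → ℝ} (r : X) (x : ℕ → X)

/-- The terminals among the first `k` that are not hubs of level `l` and have class `j`. -/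
def classTerminals (m : ℕ) (s g : ℕ → ℝ) (r : X) (x : ℕ → X) (k l : ℕ) (j : ℤ) : Finset ℕ :=
  (Finset.range k).filter fun t =>
    0 < (level m s g r x t l).gap (x t) ∧ (level m s g r x t l).cls (x t) = j

/-- The hubs of level `l` of scale `j`, other than the root, after `k` terminals. -/
def scaleHubs (m : ℕ) (s g : ℕ → ℝ) (r : X) (x : ℕ → X) (k l : ℕ) (j : ℤ) : Finset X :=
  ((level m s g r x k l).hubs.toFinset.erase r).filter fun u => (level m s g r x k l).scale u = j

theorem sum_gap_class_le (hs : ∀ l, 0 ≤ s l) (hg : ∀ l, 0 ≤ g l)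
    {k : ℕ} (Q : Fin k → List X) (hQ : ∀ t : Fin k, IsPath (x t) r (Q t))
    (l : ℕ) (j : ℤ) :
    ∑ t ∈ classTerminals m s g r x k l j, g l * (level m s g r x t l).gap (x t) ≤
      64 * ∑ e ∈ allEdges Q, edgeLen e * (capacity m s g l (load Q e) + g l) := by
  set c : ℕ → ℝ := fun t => if 0 < (level m s g r x t l).gap (x t) ∧
    (level m s g r x t l).cls (x t) = j then g l else 0 with hc
  have hj : (0 : ℝ) < 2 ^ j := by positivity
  have key := mul_sum_weight_le x Q hQ (2 ^ j / 16) c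
    (fun t => by simp only [hc]; split_ifs; exacts [hg l, le_rfl])
    (fun t ht => ?_) (fun n => capacity m s g l n + g l) (fun z T => ?_)
  · have h1 : ∑ t ∈ classTerminals m s g r x k l j, g l * (level m s g r x t l).gap (x t) ≤
        2 ^ (j + 1) * ∑ t ∈ Finset.range k, c t := by
      rw [Finset.mul_sum, classTerminals, Finset.sum_filter]
      refine Finset.sum_le_sum fun t _ => ?_
      simp only [hc]
      split_ifs with h
      · rw [mul_comm]
        refine mul_le_mul_of_nonneg_right ?_ (hg l)
        rw [← h.2]
        exact (gap_lt_two_zpow_cls _ _).le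
      · simp
    rw [zpow_add_one₀ (by norm_num)] at h1
    linarith
  · have h : 0 < (level m s g r x t l).gap (x t) ∧ (level m s g r x t l).cls (x t) = j := by
      by_contra h
      exact ht (by simp only [hc, if_neg h])
    have h1 := two_zpow_cls_le h.1
    rw [h.2] at h1
    have h2 := gap_le_dist (root_mem_hubs (Threshold m s g l) r x t) (x t)
    unfold level at h1
    linarith
  · set B := (T.filter fun t => dist (x t) z < 2 ^ j / 16).filter fun t =>
      0 < (level m s g r x t l).gap (x t) ∧ (level m s g r x t l).cls (x t) = j with hB
    have h1 : ∑ t ∈ T with dist (x t) z < 2 ^ j / 16, c t = g l * B.card := by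
      rw [hB, ← Finset.sum_filter, Finset.sum_const, nsmul_eq_mul, mul_comm]
    have h2 : (B.card : ℝ) ≤ T.card := by
      exact_mod_cast Finset.card_le_card
        ((Finset.filter_subset _ _).trans (Finset.filter_subset _ _))
    have h3 := mul_le_mul_of_nonneg_left h2 (hg l)
    rw [h1]
    rcases Nat.lt_or_ge 1 B.card with hB1 | hB1
    · unfold capacity
      split_ifs with hl
      · have h4 := not_ok_card_sub_one (ok := Threshold m s g l) r x
          (fun a b => Threshold.mono (hg l)) j B (fun t ht => (Finset.mem_filter.1 ht).2)
          (fun t ht t' ht' => ?_) hB1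
        · have h5 : g l * ((B.card - 1 : ℕ) : ℝ) < s l := by
            by_contra! h
            exact h4 ⟨hl, h⟩
          rw [Nat.cast_sub hB1.le, Nat.cast_one] at h5
          rw [← sub_le_iff_le_add]
          refine le_min ?_ ?_ <;> linarith [hg l]
        · have h5 := (Finset.mem_filter.1 (Finset.mem_filter.1 ht).1).2
          have h6 := (Finset.mem_filter.1 (Finset.mem_filter.1 ht').1).2
          have := dist_triangle_right (x t) (x t') z
          linarith
      · linarith [hg l]
    · have h4 : (B.card : ℝ) ≤ 1 := by exact_mod_cast hB1
      have := mul_le_mul_of_nonneg_left h4 (hg l)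
      have := capacity_nonneg (m := m) hs hg l T.card
      linarith

theorem sum_gap_class_le_card (hg : ∀ l, 0 ≤ g l) (k l : ℕ) (j : ℤ) :
    ∑ t ∈ classTerminals m s g r x k l j, g l * (level m s g r x t l).gap (x t) ≤
      2 * 2 ^ j * k * g l := by
  have h1 : ∑ t ∈ classTerminals m s g r x k l j, g l * (level m s g r x t l).gap (x t) ≤
      (classTerminals m s g r x k l j).card • (g l * 2 ^ (j + 1)) := by
    refine Finset.sum_le_card_nsmul _ _ _ fun t ht => mul_le_mul_of_nonneg_left ?_ (hg l)
    rw [← (Finset.mem_filter.1 ht).2.2]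
    exact (gap_lt_two_zpow_cls _ _).le
  have h2 : ((classTerminals m s g r x k l j).card : ℝ) ≤ k := by
    exact_mod_cast (Finset.card_filter_le _ _).trans (Finset.card_range k).le
  have h3 : 0 ≤ g l * 2 ^ (j + 1) := mul_nonneg (hg l) (by positivity)
  rw [nsmul_eq_mul] at h1
  have h4 := mul_le_mul_of_nonneg_right h2 h3
  rw [zpow_add_one₀ (by norm_num)] at h1 h4
  linarith

/-- Hubs of the same level and scale were paid for by disjoint sets of terminals. -/
theorem exists_terminals_near_scaleHubs (k l : ℕ) (j : ℤ) :
    ∃ P : X → Finset ℕ, ∀ u ∈ scaleHubs m s g r x k l j,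
      P u ⊆ Finset.range k ∧ (P u).Nonempty ∧ s l ≤ g l * (P u).card ∧
      (∀ t ∈ P u, dist u (x t) ≤ 2 ^ j / 8) ∧ 2 ^ j < 2 * dist u r ∧
      ∀ u' ∈ scaleHubs m s g r x k l j, u ≠ u' → 2 ^ j < 2 * dist u u' := by
  have h : ∀ u, ∃ P : Finset ℕ, u ∈ scaleHubs m s g r x k l j →
      P ⊆ Finset.range k ∧ P.Nonempty ∧ s l ≤ g l * P.card ∧
      (∀ t ∈ P, dist u (x t) ≤ 2 ^ j / 8) ∧ 2 ^ j < 2 * dist u r ∧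
      ∀ u' ∈ scaleHubs m s g r x k l j, u ≠ u' → 2 ^ j < 2 * dist u u' := by
    intro u
    by_cases hu : u ∈ scaleHubs m s g r x k l j
    · have hu' := hu
      simp only [scaleHubs, Finset.mem_filter, Finset.mem_erase, List.mem_toFinset] at hu'
      obtain ⟨⟨hur, hu'⟩, rfl⟩ := hu'
      obtain ⟨P, h1, h2, h3, h4⟩ := exists_terminals_near_hub (Threshold m s g l) r x hu' hur
      refine ⟨P, fun _ => ⟨h1, h2, h3.2, h4, two_zpow_scale_lt_dist_root _ r x hu' hur, ?_⟩⟩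
      intro w hw hne
      simp only [scaleHubs, Finset.mem_filter, Finset.mem_erase, List.mem_toFinset] at hw
      exact two_zpow_scale_lt_dist _ r x hu' hur hw.1.2 hw.1.1 hne hw.2.symm
    · exact ⟨∅, fun h => absurd h hu⟩
  choose P hP using h
  exact ⟨P, hP⟩

theorem sum_scaleHubs_le (hs : ∀ l, 0 ≤ s l) (hg : ∀ l, 0 ≤ g l)
    {k : ℕ} (Q : Fin k → List X) (hQ : ∀ t : Fin k, IsPath (x t) r (Q t))
    {l : ℕ} (hl : l < m) (j : ℤ) :
    s l * 2 ^ j * (scaleHubs m s g r x k l j).card ≤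
      32 * ∑ e ∈ allEdges Q, edgeLen e * capacity m s g l (load Q e) := by
  obtain ⟨P, hP⟩ := exists_terminals_near_scaleHubs (m := m) (s := s) (g := g) r x k l j
  set H := scaleHubs m s g r x k l j
  set c : ℕ → ℝ := fun t => ∑ u ∈ H, if t ∈ P u then s l / (P u).card else 0 with hc
  have hj : (0 : ℝ) < 2 ^ j := by positivity
  have hcard : ∀ u ∈ H, (0 : ℝ) < (P u).card := fun u hu => by
    exact_mod_cast Finset.card_pos.2 (hP u hu).2.1
  have key := mul_sum_weight_le x Q hQ (2 ^ j / 16) c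
    (fun t => Finset.sum_nonneg fun u _ => by
      split_ifs
      · exact div_nonneg (hs l) (Nat.cast_nonneg _)
      · exact le_rfl)
    (fun t ht => ?_) (fun n => capacity m s g l n) (fun z T => ?_)
  · have h1 : ∑ t ∈ Finset.range k, c t = s l * H.card := by
      simp only [hc]
      rw [Finset.sum_comm, mul_comm, ← nsmul_eq_mul, ← Finset.sum_const]
      refine Finset.sum_congr rfl fun u hu => ?_
      rw [← Finset.sum_filter, Finset.filter_mem_eq_inter,
        Finset.inter_eq_right.2 (hP u hu).1, Finset.sum_const, nsmul_eq_mul,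
        mul_div_cancel₀ _ (hcard u hu).ne']
    rw [h1] at key
    linarith
  · obtain ⟨u, hu, hne⟩ := Finset.exists_ne_zero_of_sum_ne_zero ht
    have htP : t ∈ P u := by
      by_contra h
      exact hne (if_neg h)
    obtain ⟨-, -, -, h1, h2, -⟩ := hP u hu
    have := dist_triangle u (x t) r
    linarith [h1 t htP]
  · set B := T.filter fun t => dist (x t) z < 2 ^ j / 16 with hB
    have h1 : ∑ t ∈ B, c t = ∑ u ∈ H, ((B ∩ P u).card : ℝ) * (s l / (P u).card) := by
      simp only [hc]
      rw [Finset.sum_comm]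
      refine Finset.sum_congr rfl fun u _ => ?_
      rw [← Finset.sum_filter, Finset.filter_mem_eq_inter, Finset.sum_const, nsmul_eq_mul]
    rw [h1]
    by_cases hall : ∀ u ∈ H, B ∩ P u = ∅
    · rw [Finset.sum_eq_zero fun u hu => by rw [hall u hu]; simp]
      exact capacity_nonneg hs hg l _
    push Not at hall
    obtain ⟨u, hu, t, ht⟩ := hall
    rw [Finset.mem_inter] at ht
    obtain ⟨-, -, h2, h3, -, h4⟩ := hP u hu
    rw [Finset.sum_eq_single_of_mem u hu]
    · have h5 : ((B ∩ P u).card : ℝ) ≤ (P u).card := by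
        exact_mod_cast Finset.card_le_card Finset.inter_subset_right
      have h6 : ((B ∩ P u).card : ℝ) ≤ T.card := by
        exact_mod_cast Finset.card_le_card
          (Finset.inter_subset_left.trans (Finset.filter_subset _ _))
      have h7 : s l / (P u).card ≤ g l := (div_le_iff₀ (hcard u hu)).2 h2
      have h8 : 0 ≤ s l / (P u).card := div_nonneg (hs l) (Nat.cast_nonneg _)
      rw [capacity, if_pos hl]
      refine le_min ?_ ?_
      · calc ((B ∩ P u).card : ℝ) * (s l / (P u).card) ≤ T.card * g l := by gcongr
          _ = g l * T.card := mul_comm _ _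
      · calc ((B ∩ P u).card : ℝ) * (s l / (P u).card) ≤ (P u).card * (s l / (P u).card) := by
              gcongr
          _ = s l := mul_div_cancel₀ _ (hcard u hu).ne'
    · intro w hw hne
      have : B ∩ P w = ∅ := by
        by_contra h
        obtain ⟨t', ht'⟩ := Finset.nonempty_iff_ne_empty.2 h
        rw [Finset.mem_inter] at ht'
        have e1 := (Finset.mem_filter.1 ht.1).2
        have e2 := (Finset.mem_filter.1 ht'.1).2
        have e3 := h4 w hw hne.symm
        have e4 := h3 t ht.2
        have e5 := (hP w hw).2.2.2.1 t' ht'.2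
        have e6 := dist_triangle4_right u w (x t) (x t')
        have e7 := dist_triangle_right (x t) (x t') z
        linarith
      rw [this]
      simp

theorem sum_scaleHubs_le_card (hg : ∀ l, 0 ≤ g l) (k l : ℕ) (j : ℤ) :
    s l * (scaleHubs m s g r x k l j).card ≤ k * g l := by
  obtain ⟨P, hP⟩ := exists_terminals_near_scaleHubs (m := m) (s := s) (g := g) r x k l j
  set H := scaleHubs m s g r x k l j
  have hj : (0 : ℝ) < 2 ^ j := by positivity
  have hdisj : ∀ u ∈ H, ∀ w ∈ H, u ≠ w → Disjoint (P u) (P w) := by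
    intro u hu w hw hne
    rw [Finset.disjoint_left]
    intro t ht ht'
    have e3 := (hP u hu).2.2.2.2.2 w hw hne
    have e4 := (hP u hu).2.2.2.1 t ht
    have e5 := (hP w hw).2.2.2.1 t ht'
    have e6 := dist_triangle_right u w (x t)
    linarith
  have h1 : ∑ u ∈ H, (P u).card ≤ k := by
    rw [← Finset.card_biUnion hdisj]
    simpa using Finset.card_le_card (Finset.biUnion_subset.2 fun u hu => (hP u hu).1)
  calc s l * H.card = ∑ u ∈ H, s l := by rw [Finset.sum_const, nsmul_eq_mul, mul_comm]
    _ ≤ ∑ u ∈ H, g l * (P u).card := Finset.sum_le_sum fun u hu => (hP u hu).2.2.1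
    _ = (∑ u ∈ H, (P u).card : ℕ) * g l := by rw [← Finset.mul_sum, mul_comm]; push_cast; rfl
    _ ≤ k * g l := mul_le_mul_of_nonneg_right (by exact_mod_cast h1) (hg l)

end charging

end HubState

namespace HubState

/-- The total charge of all levels and scales is bounded by the cost of any routing. -/
theorem sum_levels_le {m : ℕ} {s g : ℕ → ℝ} (hs : ∀ l, 0 ≤ s l) (hg : ∀ l, 0 ≤ g l)
    (hg0 : 0 < g 0) (r : X) (x : ℕ → X) {k : ℕ} (hk : 1 ≤ k) (Q : Fin k → List X)
    (hQ : ∀ t : Fin k, IsPath (x t) r (Q t)) (κ : Sym2 X → ℝ)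
    (hκ : ∀ e ∈ allEdges Q,
      ∑ l ∈ Finset.range (m + 1), (capacity m s g l (load Q e) + g l) ≤ 66 * κ e) :
    ∑ l ∈ Finset.range (m + 1), ∑ t ∈ Finset.range k, g l * (level m s g r x t l).gap (x t) +
      ∑ l ∈ Finset.range m, s l * ∑ u ∈ (level m s g r x k l).hubs.toFinset.erase r,
        2 ^ (level m s g r x k l).scale u ≤
      25344 * (1 + Real.logb 2 k) * ∑ e ∈ allEdges Q, edgeLen e * κ e := by
  set cost := ∑ e ∈ allEdges Q, edgeLen e * κ e with hcost
  set G := ∑ l ∈ Finset.range (m + 1), g l with hG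
  have hGpos : 0 < G := Finset.sum_pos' (fun l _ => hg l) ⟨0, by simp, hg0⟩
  have hGκ : ∀ e ∈ allEdges Q, G ≤ 66 * κ e := fun e he =>
    (Finset.sum_le_sum fun l _ => le_add_of_nonneg_left (capacity_nonneg hs hg l _)).trans (hκ e he)
  have hcost0 : 0 ≤ cost := Finset.sum_nonneg fun e he =>
    mul_nonneg (edgeLen_nonneg e) (by linarith [hGκ e he])
  set D := 66 * cost / G with hD
  have hdist : ∀ t < k, dist (x t) r ≤ D := by
    intro t ht
    rw [hD, le_div_iff₀ hGpos]
    have h1 : dist (x t) r ≤ ∑ e ∈ allEdges Q, edgeLen e :=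
      (hQ ⟨t, ht⟩).dist_le.trans (Finset.sum_le_sum_of_subset_of_nonneg
        (fun e he => Finset.mem_biUnion.2 ⟨⟨t, ht⟩, Finset.mem_univ _, he⟩)
        fun e _ _ => edgeLen_nonneg e)
    calc dist (x t) r * G ≤ (∑ e ∈ allEdges Q, edgeLen e) * G := by gcongr
      _ = ∑ e ∈ allEdges Q, edgeLen e * G := Finset.sum_mul _ _ _
      _ ≤ ∑ e ∈ allEdges Q, edgeLen e * (66 * κ e) := Finset.sum_le_sum fun e he =>
          mul_le_mul_of_nonneg_left (hGκ e he) (edgeLen_nonneg e)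
      _ = 66 * cost := by
          rw [hcost, Finset.mul_sum]
          exact Finset.sum_congr rfl fun e _ => by ring
  set T : ℕ → Finset ℕ := fun l =>
    (Finset.range k).filter fun t => 0 < (level m s g r x t l).gap (x t) with hT
  set J : Finset ℤ := (Finset.range (m + 1)).biUnion fun l =>
    (T l).image (fun t => (level m s g r x t l).cls (x t)) ∪
      ((level m s g r x k l).hubs.toFinset.erase r).image (level m s g r x k l).scale with hJ
  have hJT : ∀ l ∈ Finset.range (m + 1), ∀ t ∈ T l, (level m s g r x t l).cls (x t) ∈ J :=
    fun l hl t ht => Finset.mem_biUnion.2 ⟨l, hl, Finset.mem_union_left _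
      (Finset.mem_image_of_mem _ ht)⟩
  have hJH : ∀ l ∈ Finset.range m, ∀ u ∈ (level m s g r x k l).hubs.toFinset.erase r,
      (level m s g r x k l).scale u ∈ J :=
    fun l hl u hu => Finset.mem_biUnion.2 ⟨l, Finset.range_subset_range.2 (Nat.le_succ m) hl,
      Finset.mem_union_right _ (Finset.mem_image_of_mem _ hu)⟩
  have hJD : ∀ j ∈ J, (2 : ℝ) ^ j ≤ 2 * D := by
    intro j hj
    simp only [hJ, hT, Finset.mem_biUnion, Finset.mem_union, Finset.mem_image, Finset.mem_filter,
      Finset.mem_range, Finset.mem_erase, List.mem_toFinset] at hj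
    obtain ⟨l, -, ⟨t, ⟨ht, hpos⟩, rfl⟩ | ⟨u, ⟨hur, hu⟩, rfl⟩⟩ := hj
    · have h1 := gap_le_dist (root_mem_hubs (Threshold m s g l) r x t) (x t)
      have h2 := two_zpow_cls_le hpos
      have h3 := hdist t ht
      have h4 : 0 ≤ dist (x t) r := dist_nonneg
      change (level m s g r x t l).gap (x t) ≤ _ at h1
      linarith
    · have h1 := two_zpow_scale_lt_dist_root _ r x hu hur
      obtain ⟨t, ht, -, rfl⟩ := exists_opens_of_mem_hubs _ r x hu hur
      have h2 := hdist t ht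
      unfold level
      linarith
  set E : ℤ → ℝ := fun j =>
    ∑ l ∈ Finset.range (m + 1), ∑ t ∈ classTerminals m s g r x k l j,
      g l * (level m s g r x t l).gap (x t) +
    ∑ l ∈ Finset.range m, s l * 2 ^ j * (scaleHubs m s g r x k l j).card with hE
  have hsum : ∑ l ∈ Finset.range (m + 1), ∑ t ∈ Finset.range k,
      g l * (level m s g r x t l).gap (x t) +
      ∑ l ∈ Finset.range m, s l * ∑ u ∈ (level m s g r x k l).hubs.toFinset.erase r,
        (2 : ℝ) ^ (level m s g r x k l).scale u = ∑ j ∈ J, E j := by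
    rw [hE, Finset.sum_add_distrib, Finset.sum_comm (s := J), Finset.sum_comm (s := J)]
    congr 1
    · refine Finset.sum_congr rfl fun l hl => ?_
      have h1 : ∑ t ∈ Finset.range k, g l * (level m s g r x t l).gap (x t) =
          ∑ t ∈ T l, g l * (level m s g r x t l).gap (x t) := by
        refine (Finset.sum_filter_of_ne fun t _ hne => ?_).symm
        exact lt_of_le_of_ne (gap_nonneg _ _) fun h => hne (by rw [← h, mul_zero])
      rw [h1, ← Finset.sum_fiberwise_of_maps_to (hJT l hl)]
      refine Finset.sum_congr rfl fun j _ => ?_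
      rw [hT, Finset.filter_filter, classTerminals]
    · refine Finset.sum_congr rfl fun l hl => ?_
      rw [← Finset.sum_fiberwise_of_maps_to (hJH l hl), Finset.mul_sum]
      refine Finset.sum_congr rfl fun j _ => ?_
      rw [Finset.sum_congr rfl fun u hu => by rw [(Finset.mem_filter.1 hu).2], Finset.sum_const,
        nsmul_eq_mul, scaleHubs]
      ring
  have hE1 : ∀ j, E j ≤ 6336 * cost := by
    intro j
    have h1 : ∀ l ∈ Finset.range m, s l * 2 ^ j * (scaleHubs m s g r x k l j).card ≤
        32 * ∑ e ∈ allEdges Q, edgeLen e * (capacity m s g l (load Q e) + g l) := by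
      intro l hl
      refine (sum_scaleHubs_le r x hs hg Q hQ (Finset.mem_range.1 hl) j).trans ?_
      gcongr with e _
      · exact edgeLen_nonneg e
      · exact le_add_of_nonneg_right (hg l)
    have h2 : ∑ l ∈ Finset.range m, s l * 2 ^ j * (scaleHubs m s g r x k l j).card ≤
        ∑ l ∈ Finset.range (m + 1),
          32 * ∑ e ∈ allEdges Q, edgeLen e * (capacity m s g l (load Q e) + g l) :=
      (Finset.sum_le_sum h1).trans (Finset.sum_le_sum_of_subset_of_nonneg
        (Finset.range_subset_range.2 (Nat.le_succ m)) fun l _ _ => mul_nonneg (by norm_num)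
          (Finset.sum_nonneg fun e _ => mul_nonneg (edgeLen_nonneg e)
            (add_nonneg (capacity_nonneg hs hg l _) (hg l))))
    have h3 := Finset.sum_le_sum fun l (_ : l ∈ Finset.range (m + 1)) =>
      sum_gap_class_le (m := m) r x hs hg Q hQ l j
    have h4 : ∑ l ∈ Finset.range (m + 1), ∑ e ∈ allEdges Q,
        edgeLen e * (capacity m s g l (load Q e) + g l) ≤ 66 * cost := by
      rw [Finset.sum_comm, hcost, Finset.mul_sum]
      refine Finset.sum_le_sum fun e he => ?_
      rw [← Finset.mul_sum]
      have := mul_le_mul_of_nonneg_left (hκ e he) (edgeLen_nonneg e)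
      linarith
    rw [← Finset.mul_sum] at h2 h3
    simp only [hE]
    linarith
  have hE2 : ∀ j, E j ≤ 3 * 2 ^ j * k * G := by
    intro j
    have h1 := Finset.sum_le_sum fun l (_ : l ∈ Finset.range (m + 1)) =>
      sum_gap_class_le_card (m := m) (s := s) r x hg k l j
    have h2 : ∑ l ∈ Finset.range m, s l * 2 ^ j * (scaleHubs m s g r x k l j).card ≤
        ∑ l ∈ Finset.range (m + 1), 2 ^ j * k * g l := by
      refine (Finset.sum_le_sum fun l _ => ?_).trans (Finset.sum_le_sum_of_subset_of_nonneg
        (Finset.range_subset_range.2 (Nat.le_succ m))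
          fun l _ _ => mul_nonneg (by positivity) (hg l))
      have h3 := mul_le_mul_of_nonneg_left
        (sum_scaleHubs_le_card (m := m) (s := s) r x hg k l j)
        (by positivity : (0 : ℝ) ≤ 2 ^ j)
      linarith
    rw [← Finset.mul_sum, ← hG] at h1 h2
    simp only [hE]
    linarith
  have hlog : 0 ≤ 1 + Real.logb 2 k := by
    have := Real.logb_nonneg (by norm_num : (1 : ℝ) < 2) (by exact_mod_cast hk : (1 : ℝ) ≤ k)
    linarith
  rw [hsum]
  rcases lt_or_ge 0 D with hDpos | hDneg
  · have hE3 : ∀ j, E j ≤ 6336 * cost * min 1 ((2 : ℝ) ^ j * k / D) := by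
      intro j
      rw [mul_min_of_nonneg _ _ (by positivity)]
      refine le_min (by linarith [hE1 j]) ((hE2 j).trans ?_)
      have h1 : G * D = 66 * cost := mul_div_cancel₀ _ hGpos.ne'
      have h2 : 6336 * cost * ((2 : ℝ) ^ j * k / D) = 96 * 2 ^ j * k * G := by
        rw [mul_div_assoc', div_eq_iff hDpos.ne']
        linear_combination (-96) * 2 ^ j * k * h1
      rw [h2]
      have : 0 ≤ (2 : ℝ) ^ j * k * G := by positivity
      linarith
    calc ∑ j ∈ J, E j ≤ ∑ j ∈ J, 6336 * cost * min 1 ((2 : ℝ) ^ j * k / D) :=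
          Finset.sum_le_sum fun j _ => hE3 j
      _ ≤ 6336 * cost * (4 * (1 + Real.logb 2 k)) := by
          rw [← Finset.mul_sum]
          exact mul_le_mul_of_nonneg_left (sum_min_one_two_zpow_le J D hDpos k hk hJD)
            (by positivity)
      _ = 25344 * (1 + Real.logb 2 k) * cost := by ring
  · have : J = ∅ := Finset.eq_empty_of_forall_notMem fun j hj => by
      have h1 := hJD j hj
      have h2 : (0 : ℝ) < 2 ^ j := by positivity
      linarith
    rw [this, Finset.sum_empty]
    positivity

end HubState

namespace HubState

/-- An online algorithm routing every terminal along the nets of the levels. -/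
theorem exists_online_routing {m : ℕ} (hm : 1 ≤ m) {s g : ℕ → ℝ} (hg : ∀ l, 0 ≤ g l)
    (h0 : s 0 = g 0) (hdec : ∀ l, l + 1 < m → 32 * g (l + 2) ≤ g (l + 1)) (r : X) :
    ∃ A : List X → List X × (Sym2 X → ℕ), (∀ l y, IsPath y r (A (l ++ [y])).1) ∧
      ∀ (k : ℕ) (v : Fin k → X) (x : ℕ → X), (∀ t : Fin k, x t = v t) → ∀ t : Fin k,
        (∀ e ∈ edgeList (A ((List.ofFn v).take (↑t + 1))).1,
          (A ((List.ofFn v).take (↑t + 1))).2 e < m ∧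
          e ∈ net r (level m s g r x k ((A ((List.ofFn v).take (↑t + 1))).2 e))
            (level m s g r x k ((A ((List.ofFn v).take (↑t + 1))).2 e + 1))) ∧
        ∑ e ∈ (edgeList (A ((List.ofFn v).take (↑t + 1))).1).toFinset,
          g ((A ((List.ofFn v).take (↑t + 1))).2 e + 1) * edgeLen e ≤
          16 * ∑ i ∈ Finset.range m, g (i + 1) * (level m s g r x t (i + 1)).gap (x t) := by
  choose p ty h1 h2 h3 using fun x t => exists_route hm hg h0 hdec r x t
  refine ⟨fun l => (p (fun i => l.getD i r) (l.length - 1),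
      ty (fun i => l.getD i r) (l.length - 1)),
    fun l y => ?_, fun k v x hx t => ?_⟩
  · have := h1 (fun i => (l ++ [y]).getD i r) ((l ++ [y]).length - 1)
    simpa using this
  · have hlen : ((List.ofFn v).take (↑t + 1)).length - 1 = t := by
      have := t.isLt
      simp
    beta_reduce
    rw [hlen]
    set y : ℕ → X := fun i => ((List.ofFn v).take (↑t + 1)).getD i r
    have hy : ∀ i < (t : ℕ) + 1, y i = x i := by
      intro i hi
      have hik : i < k := by have := t.isLt; omega
      rw [hx ⟨i, hik⟩]
      simp [y, List.getD_eq_getElem?_getD, List.getElem?_take, Nat.lt_succ_iff.1 hi, hik]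
    have hlevel : ∀ t' ≤ (t : ℕ) + 1, ∀ l, level m s g r y t' l = level m s g r x t' l :=
      fun t' ht' l => run_congr _ r fun i hi => hy i (by omega)
    refine ⟨fun e he => ?_, ?_⟩
    · obtain ⟨h4, h5⟩ := h2 y t e he
      rw [hlevel _ le_rfl, hlevel _ le_rfl] at h5
      exact ⟨h4, net_mono _ _ r x t.isLt h5⟩
    · refine (h3 y t).trans (le_of_eq ?_)
      rw [hy t (Nat.lt_succ_self _)]
      simp only [hlevel t (Nat.le_succ _)]

end HubState

/-- **Theorem 1 (Deterministic online single-sink buy-at-bulk).**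
There is a universal constant `C` such that for every metric space `X`, root `r`,
and cable types `σ, β` (fixed costs positive and strictly increasing, incremental
costs positive and strictly decreasing), there is an online algorithm `A`
(assigning to each prefix of terminals a path from the newest terminal to `r`
together with a cable type for every edge) whose total (fixed plus incremental)
cost on any sequence of `k ≥ 1` terminals is at most `C·(1 + log₂ k)·OPT`. -/
theorem deterministic_online_buy_at_bulk :
    ∃ C : ℝ, 0 < C ∧
      ∀ (X : Type) [MetricSpace X] (r : X) (M : ℕ), 1 ≤ M →
        ∀ σ β : Fin M → ℝ,
          (∀ i, 0 < σ i) → StrictMono σ →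
          (∀ i, 0 < β i) → StrictAnti β →
          ∃ A : List X → List X × (Sym2 X → Fin M),
            -- `A` produces, for a prefix ending at terminal `x`, a path from `x` to `r`
            -- (prefix-consistency is automatic in this representation)
            (∀ (l : List X) (x : X), IsPath x r (A (l ++ [x])).1) ∧
            ∀ (k : ℕ), 1 ≤ k → ∀ v : Fin k → X,
              -- fixed cost: each (edge, cable type) pair installed at some time is paid once
              (∑ q ∈ (Finset.univ.biUnion fun s : Fin k =>
                    (edgeList (A ((List.ofFn v).take (↑s + 1))).1).toFinset.image
                      fun e => (e, (A ((List.ofFn v).take (↑s + 1))).2 e)),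
                  σ q.2 * edgeLen q.1)
                -- incremental cost: each terminal pays the incremental cost along its path
                + (∑ s : Fin k, ∑ e ∈ (edgeList (A ((List.ofFn v).take (↑s + 1))).1).toFinset,
                    β ((A ((List.ofFn v).take (↑s + 1))).2 e) * edgeLen e)
              ≤ C * (1 + Real.logb 2 (k : ℝ)) *
                  sInf { c | ∃ (Q : Fin k → List X) (j : Sym2 X → Fin M),
                    (∀ s, IsPath (v s) r (Q s)) ∧
                    c = ∑ e ∈ allEdges Q,
                          edgeLen e * (σ (j e) + β (j e) * (load Q e : ℝ)) } := by
  refine ⟨405504, by norm_num, fun X _ r M hM σ β hσ hσm hβ hβm => ?_⟩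
  obtain ⟨m, idx, hm, hdec, hsel⟩ := exists_cable_selection hM σ β hσ hσm hβ hβm
  set s : ℕ → ℝ := fun l => σ (idx l) with hs_def
  set g : ℕ → ℝ := fun l => Nat.casesOn l (σ (idx 0)) fun i => β (idx i) with hg_def
  have hs : ∀ l, 0 ≤ s l := fun l => (hσ _).le
  have hg : ∀ l, 0 ≤ g l
    | 0 => (hσ _).le
    | _ + 1 => (hβ _).le
  obtain ⟨A, hA, hcost⟩ := HubState.exists_online_routing (s := s) (g := g) hm hg rfl hdec r
  refine ⟨fun l => ((A l).1, fun e => idx ((A l).2 e)), hA, fun k hk v => ?_⟩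
  beta_reduce
  have hlog : 0 ≤ Real.logb 2 (k : ℝ) :=
    Real.logb_nonneg (by norm_num) (by exact_mod_cast hk)
  set x : ℕ → X := fun i => if h : i < k then v ⟨i, h⟩ else r with hx_def
  have hx : ∀ t : Fin k, x t = v t := fun t => by simp [x]
  replace hcost := hcost k v x hx
  set inst := Finset.univ.biUnion fun s : Fin k =>
    (edgeList (A ((List.ofFn v).take (↑s + 1))).1).toFinset.image
      fun e => (e, idx ((A ((List.ofFn v).take (↑s + 1))).2 e)) with hinst
  have hfixed : ∑ q ∈ inst, σ q.2 * edgeLen q.1 ≤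
      9 * ∑ l ∈ Finset.range m, s l * ∑ u ∈ (HubState.level m s g r x k l).hubs.toFinset.erase r,
        2 ^ (HubState.level m s g r x k l).scale u := by
    have hnn : ∀ q : Sym2 X × Fin M, 0 ≤ σ q.2 * edgeLen q.1 :=
      fun q => mul_nonneg (hσ _).le (edgeLen_nonneg _)
    have hsub : inst ⊆ (Finset.range m).biUnion fun l =>
        (HubState.net r (HubState.level m s g r x k l)
          (HubState.level m s g r x k (l + 1))).image fun e => (e, idx l) := by
      intro q hq
      simp only [hinst, Finset.mem_biUnion, Finset.mem_image, List.mem_toFinset,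
        Finset.mem_univ, true_and] at hq
      obtain ⟨t, e, he, rfl⟩ := hq
      obtain ⟨h1, h2⟩ := (hcost t).1 e he
      exact Finset.mem_biUnion.2 ⟨_, Finset.mem_range.2 h1, Finset.mem_image_of_mem _ h2⟩
    refine (Finset.sum_le_sum_of_subset_of_nonneg hsub fun q _ _ => hnn q).trans ?_
    refine (sum_biUnion_le hnn _ _).trans ?_
    rw [Finset.mul_sum]
    refine Finset.sum_le_sum fun l _ => ?_
    refine (Finset.sum_image_le_of_nonneg fun q _ => hnn q).trans ?_
    change ∑ e ∈ _, σ (idx l) * edgeLen e ≤ _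
    rw [← Finset.mul_sum, mul_left_comm]
    exact mul_le_mul_of_nonneg_left (HubState.sum_edgeLen_net_le _ _ r x k) (hs l)
  have hincr : ∑ t : Fin k, ∑ e ∈ (edgeList (A ((List.ofFn v).take (↑t + 1))).1).toFinset,
      β (idx ((A ((List.ofFn v).take (↑t + 1))).2 e)) * edgeLen e ≤
      16 * ∑ l ∈ Finset.range (m + 1), ∑ t ∈ Finset.range k,
        g l * (HubState.level m s g r x t l).gap (x t) := by
    refine (Finset.sum_le_sum fun t _ => (hcost t).2).trans ?_
    rw [← Finset.mul_sum, Fin.sum_univ_eq_sum_range fun t => ∑ i ∈ Finset.range m,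
      g (i + 1) * (HubState.level m s g r x t (i + 1)).gap (x t), Finset.sum_comm,
      Finset.sum_range_succ']
    have : 0 ≤ ∑ t ∈ Finset.range k, g 0 * (HubState.level m s g r x t 0).gap (x t) :=
      Finset.sum_nonneg fun t _ => mul_nonneg (hg 0) (HubState.gap_nonneg _ _)
    linarith
  have hK : 0 < 405504 * (1 + Real.logb 2 (k : ℝ)) := by positivity
  rw [← div_le_iff₀' hK]
  refine le_csInf ⟨_, fun t => [v t, r], fun _ => ⟨0, hM⟩,
    fun t => isPath_cons (isPath_singleton r), rfl⟩ ?_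
  rintro _ ⟨Q, j, hQ, rfl⟩
  rw [div_le_iff₀' hK]
  have hload : ∀ e ∈ allEdges Q, 1 ≤ load Q e := by
    intro e he
    obtain ⟨t, -, ht⟩ := Finset.mem_biUnion.1 he
    exact Finset.card_pos.2 ⟨t, Finset.mem_filter.2 ⟨Finset.mem_univ _, List.mem_toFinset.1 ht⟩⟩
  have htotal := HubState.sum_levels_le (m := m) hs hg (hσ _) r x hk Q
    (fun t => by rw [hx]; exact hQ t) (fun e => σ (j e) + β (j e) * (load Q e : ℝ)) ?_
  · have h1 : 0 ≤ ∑ l ∈ Finset.range (m + 1), ∑ t ∈ Finset.range k,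
        g l * (HubState.level m s g r x t l).gap (x t) :=
      Finset.sum_nonneg fun l _ => Finset.sum_nonneg fun t _ =>
        mul_nonneg (hg l) (HubState.gap_nonneg _ _)
    have h2 : 0 ≤ ∑ l ∈ Finset.range m, s l *
        ∑ u ∈ (HubState.level m s g r x k l).hubs.toFinset.erase r,
          (2 : ℝ) ^ (HubState.level m s g r x k l).scale u :=
      Finset.sum_nonneg fun l _ => mul_nonneg (hs l) (Finset.sum_nonneg fun u _ => by positivity)
    linarith
  · intro e he
    refine le_trans (le_of_eq ?_) (hsel (j e) (load Q e) (hload e he))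
    have hn : (1 : ℝ) ≤ load Q e := by exact_mod_cast hload e he
    have h1 : HubState.capacity m s g 0 (load Q e) = σ (idx 0) := by
      rw [HubState.capacity, if_pos (by omega)]
      exact min_eq_right (le_mul_of_one_le_right (hσ _).le hn)
    rw [Finset.sum_add_distrib, Finset.sum_range_succ', Finset.sum_range_succ' g, h1]
    change (∑ l ∈ Finset.range m, (if l + 1 < m then min (β (idx l) * (load Q e : ℝ))
      (σ (idx (l + 1))) else β (idx l) * (load Q e : ℝ))) + σ (idx 0) +
      (∑ l ∈ Finset.range m, β (idx l) + σ (idx 0)) = _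
    ring
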